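/- If X is a nondegenerate unicoherent Peano continuum that is π-n-Euclidean for some n with 2 ≤ n < ∞, then C(X) \ CB(X) is strongly F_σ-universal in the Hilbert cube C(X). -/

import Mathlib

open Set Topology Metric

noncomputable section

/-- The hyperspace `2^X` of nonempty compact (= closed, for compact `X`) subsets of `X`,
with the Hausdorff metric. -/
abbrev Hyper (X : Type*) [MetricSpace X] := TopologicalSpace.NonemptyCompacts X

/-- `C(X)`: the subcontinua of `X`, i.e. the connected members of the hyperspace. -/
def CSet (X : Type*) [MetricSpace X] : Set (Hyper X) :=
  {A | IsConnected (A : Set X)}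

/-- `CB(X)`: proper subcontinua of `X` with connected boundary. -/
def CBSet (X : Type*) [MetricSpace X] : Set (Hyper X) :=
  {A | IsConnected (A : Set X) ∧ (A : Set X) ≠ Set.univ ∧
    IsConnected (frontier (A : Set X))}

/-- `S(X)`: the members of the hyperspace that separate `X`,
i.e. whose complement is disconnected. -/
def SepSet (X : Type*) [MetricSpace X] : Set (Hyper X) :=
  {A | ¬ IsPreconnected ((A : Set X)ᶜ)}

/-- A set is `F_σ` if it is a countable union of closed sets. -/
def IsFsigma {α : Type*} [TopologicalSpace α] (s : Set α) : Prop :=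
  ∃ F : ℕ → Set α, (∀ n, IsClosed (F n)) ∧ s = ⋃ n, F n

/-- A set is `F_σδ` if it is a countable intersection of `F_σ` sets. -/
def IsFsigmaDelta {α : Type*} [TopologicalSpace α] (s : Set α) : Prop :=
  ∃ F : ℕ → Set α, (∀ n, IsFsigma (F n)) ∧ s = ⋂ n, F n

/-- A set is in the class `D_2(F_σ)` if it is a difference of two `F_σ` sets. -/
def IsD2Fsigma {α : Type*} [TopologicalSpace α] (s : Set α) : Prop :=
  ∃ u v : Set α, IsFsigma u ∧ IsFsigma v ∧ s = u \ v

/-- `X` is unicoherent: the intersection of any two closed connected sets covering `X`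
is connected. -/
def Unicoherent (X : Type*) [TopologicalSpace X] : Prop :=
  ∀ A B : Set X, IsClosed A → IsClosed B → IsConnected A → IsConnected B →
    A ∪ B = Set.univ → IsConnected (A ∩ B)

/-- An arc: a subspace homeomorphic to `[0,1]`. -/
def IsArc {X : Type*} [TopologicalSpace X] (A : Set X) : Prop :=
  Nonempty (unitInterval ≃ₜ A)

/-- A free arc: an arc which becomes open after removing its two endpoints. -/
def IsFreeArc {X : Type*} [TopologicalSpace X] (A : Set X) : Prop :=
  ∃ h : unitInterval ≃ₜ A, IsOpen (A \ {((h 0 : A) : X), ((h 1 : A) : X)})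

/-- `Y` is π-`n`-Euclidean: it has a π-base consisting of open sets homeomorphic to `ℝⁿ`. -/
def PiEuclidean (Y : Type*) [TopologicalSpace Y] (n : ℕ) : Prop :=
  ∃ 𝓤 : Set (Set Y),
    (∀ U ∈ 𝓤, IsOpen U ∧ U.Nonempty ∧ Nonempty (U ≃ₜ (Fin n → ℝ))) ∧
    ∀ V : Set Y, IsOpen V → V.Nonempty → ∃ U ∈ 𝓤, U ⊆ V

/-- The Hilbert cube `I^∞ = [0,1]^ℕ`. -/
abbrev Iinf : Type := ℕ → unitInterval

/-- The pseudo-interior `(0,1)^∞` of the Hilbert cube. -/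
def pseudoInterior : Set Iinf := {t | ∀ k, 0 < (t k : ℝ) ∧ (t k : ℝ) < 1}

/-- The pseudo-boundary `∂(I^∞) = I^∞ \ (0,1)^∞` of the Hilbert cube. -/
def pseudoBoundary : Set Iinf := pseudoInteriorᶜ

/-- A `Z`-set in a (Hilbert cube) metric space `Q`: a closed set `A` such that for every
`ε > 0` the identity can be `ε`-approximated by a map avoiding `A`. -/
def IsZSet {Q : Type*} [MetricSpace Q] (A : Set Q) : Prop :=
  IsClosed A ∧ ∀ ε : ℝ, 0 < ε →
    ∃ f : Q → Q, Continuous f ∧ (∀ x, dist (f x) x < ε) ∧ ∀ x, f x ∉ A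

/-- A `σZ`-set: a countable union of `Z`-sets. -/
def IsSigmaZSet {Q : Type*} [MetricSpace Q] (A : Set Q) : Prop :=
  ∃ Z : ℕ → Set Q, (∀ n, IsZSet (Z n)) ∧ A = ⋃ n, Z n

/-- `A ⊆ Q` is strongly `𝓜`-universal (for a class `𝓜` of subsets of the Hilbert cube
`I^∞`): every embedding `f : I^∞ → Q` sending a compact set `K` onto a `Z`-set can be
approximated by an embedding `g` onto a `Z`-set which agrees with `f` on `K` and with
`g⁻¹(A) \ K = M \ K`. -/
def StronglyUniversal {Q : Type*} [MetricSpace Q] (𝓜 : Set (Set Iinf)) (A : Set Q) : Prop :=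
  ∀ M ∈ 𝓜, ∀ K : Set Iinf, IsCompact K →
    ∀ f : Iinf → Q, IsEmbedding f → IsZSet (f '' K) →
      ∀ ε : ℝ, 0 < ε →
        ∃ g : Iinf → Q, IsEmbedding g ∧ IsZSet (Set.range g) ∧
          (∀ x, dist (g x) (f x) < ε) ∧ (∀ x ∈ K, g x = f x) ∧
          g ⁻¹' A \ K = M \ K

/-- Lebesgue covering dimension `≤ n`: every open cover has an open refinement which
covers and such that each point lies in at most `n + 1` members. -/
def CoveringDimLE (α : Type*) [TopologicalSpace α] (n : ℕ) : Prop :=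
  ∀ 𝓤 : Set (Set α), (∀ U ∈ 𝓤, IsOpen U) → ⋃₀ 𝓤 = Set.univ →
    ∃ 𝓥 : Set (Set α), (∀ V ∈ 𝓥, IsOpen V) ∧ ⋃₀ 𝓥 = Set.univ ∧
      (∀ V ∈ 𝓥, ∃ U ∈ 𝓤, V ⊆ U) ∧
      ∀ (x : α) (s : Finset (Set α)), ↑s ⊆ 𝓥 → (∀ V ∈ s, x ∈ V) → s.card ≤ n + 1

/-- An indecomposable continuum: not the union of two proper subcontinua. -/
def IndecomposableCont (X : Type*) [TopologicalSpace X] : Prop :=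
  ¬ ∃ A B : Set X, IsClosed A ∧ IsClosed B ∧ IsConnected A ∧ IsConnected B ∧
    A ≠ Set.univ ∧ B ≠ Set.univ ∧ A ∪ B = Set.univ


namespace CBU

/-! ### Basic facts about the hyperspace -/

lemma isClosed_hle {X : Type*} [MetricSpace X] :
    IsClosed {p : Hyper X × Hyper X | p.1 ≤ p.2} := by
  have : {p : Hyper X × Hyper X | p.1 ≤ p.2} =
      ⋂ x : X, {p : Hyper X × Hyper X | infDist x (p.2 : Set X) ≤ infDist x (p.1 : Set X)} := by
    ext ⟨A, B⟩
    simp only [mem_ofPred_eq, mem_iInter]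
    constructor
    · intro h x
      exact infDist_le_infDist_of_subset h A.nonempty
    · intro h x hx
      have h1 := h x
      have h2 : infDist x (A : Set X) = 0 := infDist_zero_of_mem hx
      rw [h2] at h1
      have h3 : infDist x (B : Set X) = 0 := le_antisymm h1 infDist_nonneg
      exact (B.isCompact.isClosed.mem_iff_infDist_zero B.nonempty).2 h3
  rw [this]
  refine isClosed_iInter fun x => isClosed_le ?_ ?_
  · exact (Metric.lipschitz_infDist_set x).continuous.comp continuous_snd
  · exact (Metric.lipschitz_infDist_set x).continuous.comp continuous_fst

lemma isClosed_CSet {X : Type*} [MetricSpace X] : IsClosed (CSet X) := by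
  rw [← isOpen_compl_iff, isOpen_iff_mem_nhds]
  intro A hA
  have hA' : ¬ IsPreconnected (A : Set X) := fun h => hA ⟨A.nonempty, h⟩
  rw [isPreconnected_closed_iff] at hA'
  push Not at hA'
  obtain ⟨t, t', ht, ht', hsub, h1, h2, h3⟩ := hA'
  have hd : Disjoint ((A : Set X) ∩ t) ((A : Set X) ∩ t') := by
    rw [Set.disjoint_iff]
    rintro x ⟨⟨hx, hxt⟩, -, hxt'⟩
    have : x ∈ (A : Set X) ∩ (t ∩ t') := ⟨hx, hxt, hxt'⟩
    simp [h3] at this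
  obtain ⟨U, V, hU, hV, hU', hV', hUV⟩ :=
    SeparatedNhds.of_isCompact_isCompact (A.isCompact.inter_right ht) (A.isCompact.inter_right ht') hd
  have o1 := TopologicalSpace.NonemptyCompacts.isOpen_subsets_of_isOpen (hU.union hV)
  have o2 := TopologicalSpace.NonemptyCompacts.isOpen_inter_nonempty_of_isOpen hU
  have o3 := TopologicalSpace.NonemptyCompacts.isOpen_inter_nonempty_of_isOpen hV
  have m1 : A ∈ {K : Hyper X | (K : Set X) ⊆ U ∪ V} := by
    intro x hx
    rcases hsub hx with h | h
    · exact Or.inl (hU' ⟨hx, h⟩)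
    · exact Or.inr (hV' ⟨hx, h⟩)
  have m2 : A ∈ {K : Hyper X | ((K : Set X) ∩ U).Nonempty} := by
    obtain ⟨x, hx⟩ := h1
    exact ⟨x, hx.1, hU' hx⟩
  have m3 : A ∈ {K : Hyper X | ((K : Set X) ∩ V).Nonempty} := by
    obtain ⟨x, hx⟩ := h2
    exact ⟨x, hx.1, hV' hx⟩
  filter_upwards [o1.mem_nhds m1, o2.mem_nhds m2, o3.mem_nhds m3] with B hB1 hB2 hB3 hB
  obtain ⟨x, -, hx⟩ := hB.isPreconnected U V hU hV hB1 hB2 hB3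
  exact Set.disjoint_iff.1 hUV hx

/-- A Whitney map. -/
lemma exists_whitney (X : Type*) [MetricSpace X] [CompactSpace X] [Nonempty X] :
    ∃ w : Hyper X → ℝ, Continuous w ∧ StrictMono w := by
  obtain ⟨z, hz⟩ := TopologicalSpace.exists_dense_seq X
  have hbd : ∀ (n : ℕ) (A : Hyper X), |infDist (z n) (A : Set X)| ≤ diam (univ : Set X) := by
    intro n A
    obtain ⟨a, ha⟩ := A.nonempty
    rw [abs_of_nonneg infDist_nonneg]
    exact (infDist_le_dist_of_mem ha).trans
      (dist_le_diam_of_mem isCompact_univ.isBounded (mem_univ _) (mem_univ _))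
  have hs : Summable fun n : ℕ => (1 / 2 : ℝ) ^ n * diam (univ : Set X) :=
    (summable_geometric_of_lt_one (by norm_num) (by norm_num)).mul_right _
  have hb : ∀ (n : ℕ) (A : Hyper X), ‖-((1 / 2 : ℝ) ^ n * infDist (z n) (A : Set X))‖ ≤
      (1 / 2 : ℝ) ^ n * diam (univ : Set X) := by
    intro n A
    rw [norm_neg, norm_mul, Real.norm_eq_abs, Real.norm_eq_abs, abs_of_pos (by positivity)]
    gcongr
    exact hbd n A
  have hsum : ∀ A : Hyper X, Summable fun n => -((1 / 2 : ℝ) ^ n * infDist (z n) (A : Set X)) :=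
    fun A => Summable.of_norm_bounded hs (fun n => hb n A)
  refine ⟨fun A => ∑' n, -((1 / 2 : ℝ) ^ n * infDist (z n) (A : Set X)), ?_, ?_⟩
  · refine continuous_tsum (fun n => ?_) hs hb
    exact (continuous_const.mul
      (Metric.lipschitz_infDist_set (z n)).continuous).neg
  · intro A B hAB
    obtain ⟨hle, hne⟩ := lt_iff_le_not_ge.1 hAB
    have : ∃ b ∈ (B : Set X), b ∉ (A : Set X) := by
      by_contra h
      push Not at h
      exact hne h
    obtain ⟨b, hb1, hb2⟩ := this
    have hpos : 0 < infDist b (A : Set X) :=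
      (A.isCompact.isClosed.notMem_iff_infDist_pos A.nonempty).1 hb2
    obtain ⟨n, hn⟩ := hz.exists_dist_lt b (half_pos hpos)
    refine Summable.tsum_lt_tsum (i := n) (fun k => ?_) ?_ (hsum A) (hsum B)
    · have := infDist_le_infDist_of_subset (x := z k) hle A.nonempty
      have h2 : (0:ℝ) < (1/2)^k := by positivity
      have := mul_le_mul_of_nonneg_left this h2.le
      exact neg_le_neg this
    · have h1 : infDist (z n) (B : Set X) ≤ dist b (z n) := by
        rw [dist_comm]; exact infDist_le_dist_of_mem hb1
      have h2 : infDist b (A : Set X) ≤ infDist (z n) (A : Set X) + dist b (z n) :=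
        infDist_le_infDist_add_dist
      have h3 : infDist (z n) (B : Set X) < infDist (z n) (A : Set X) := by linarith
      have h4 : (0:ℝ) < (1/2)^n := by positivity
      have := mul_lt_mul_of_pos_left h3 h4
      exact neg_lt_neg this

/-- Between two nested continua there is a third one. -/
lemma exists_between_continua {X : Type*} [MetricSpace X] {A B : Hyper X} (hA : A ∈ CSet X)
    (hB : B ∈ CSet X) (hAB : A < B) : ∃ D ∈ CSet X, A < D ∧ D < B := by
  obtain ⟨hle, hne⟩ := lt_iff_le_not_ge.1 hAB
  have : ∃ b ∈ (B : Set X), b ∉ (A : Set X) := by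
    by_contra h
    push Not at h
    exact hne h
  obtain ⟨b, hb1, hb2⟩ := this
  have hpos : 0 < infDist b (A : Set X) :=
    (A.isCompact.isClosed.notMem_iff_infDist_pos A.nonempty).1 hb2
  obtain ⟨η, hη0, hη⟩ := exists_between hpos
  set W : Set X := (B : Set X) ∩ {y | infDist y (A : Set X) ≤ η} with hW
  have hWc : IsCompact W :=
    B.isCompact.inter_right (isClosed_le (continuous_infDist_pt _) continuous_const)
  obtain ⟨a, ha⟩ := A.nonempty
  have hAW : (A : Set X) ⊆ W := fun x hx => ⟨hle hx, by
    simp only [mem_ofPred_eq, infDist_zero_of_mem hx, hη0.le]⟩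
  have haW := hAW ha
  have hbW : b ∉ W := fun h => not_lt.2 h.2 hη
  have : CompactSpace W := isCompact_iff_compactSpace.1 hWc
  set a' : W := ⟨a, haW⟩
  set D : Set X := connectedComponentIn W a with hD
  have hDeq : D = (Subtype.val : W → X) '' connectedComponent a' :=
    connectedComponentIn_eq_image haW
  have hDc : IsCompact D := by
    rw [hDeq]
    exact (isClosed_connectedComponent.isCompact).image continuous_subtype_val
  have hDW : D ⊆ W := connectedComponentIn_subset _ _
  have hAD : (A : Set X) ⊆ D := hA.isPreconnected.subset_connectedComponentIn ha hAW
  have hDA : D ≠ (A : Set X) := by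
    intro hDA
    have : Nonempty {s : Set W // IsClopen s ∧ a' ∈ s} := ⟨⟨univ, isClopen_univ, mem_univ _⟩⟩
    have key : ∃ i : {s : Set W // IsClopen s ∧ a' ∈ s}, (i : Set W) ⊆
        {y : W | infDist (y : X) (A : Set X) < η} := by
      refine exists_subset_nhds_of_isCompact (V := fun i : {s : Set W // IsClopen s ∧ a' ∈ s} =>
        (i : Set W)) ?_ (fun i => i.2.1.isClosed.isCompact) ?_
      · rintro ⟨s, hs, has⟩ ⟨t, ht, hat⟩
        exact ⟨⟨s ∩ t, hs.inter ht, has, hat⟩, inter_subset_left, inter_subset_right⟩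
      · intro x hx
        rw [← connectedComponent_eq_iInter_isClopen] at hx
        have hxA : (x : X) ∈ (A : Set X) := by
          rw [← hDA, hDeq]; exact ⟨x, hx, rfl⟩
        refine IsOpen.mem_nhds ?_ ?_
        · exact isOpen_lt ((continuous_infDist_pt _).comp continuous_subtype_val) continuous_const
        · simp only [mem_ofPred_eq, infDist_zero_of_mem hxA, hη0]
    obtain ⟨⟨Z, hZ, haZ⟩, hZs⟩ := key
    simp only at hZs
    obtain ⟨O, hO, hOZ⟩ := isOpen_induced_iff.1 hZ.isOpen
    have hZimg : IsClosed ((Subtype.val : W → X) '' Z) :=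
      (hZ.isClosed.isCompact.image continuous_subtype_val).isClosed
    set O' := O ∩ {y | infDist y (A : Set X) < η} with hO'
    have hO'o : IsOpen O' := hO.inter (isOpen_lt (continuous_infDist_pt _) continuous_const)
    have hcov : (B : Set X) ⊆ O' ∪ ((Subtype.val : W → X) '' Z)ᶜ := by
      intro y hy
      by_cases h : y ∈ (Subtype.val : W → X) '' Z
      · left
        obtain ⟨y', hy', rfl⟩ := h
        refine ⟨?_, hZs hy'⟩
        rw [← hOZ] at hy'
        exact hy'
      · right; exact h
    obtain ⟨y, hyB, hy1, hy2⟩ := hB.isPreconnected O' _ hO'o hZimg.isOpen_compl hcov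
      ⟨a, hle ha, by
        have : a' ∈ Subtype.val ⁻¹' O := by rw [hOZ]; exact haZ
        exact this, by simp only [mem_ofPred_eq, infDist_zero_of_mem ha, hη0]⟩
      ⟨b, hb1, by
        rintro ⟨y, -, rfl⟩
        exact hbW y.2⟩
    apply hy2
    have hyW : y ∈ W := ⟨hyB, by have h : infDist y (A : Set X) < η := hy1.2; exact h.le⟩
    refine ⟨⟨y, hyW⟩, ?_, rfl⟩
    rw [← hOZ]
    exact hy1.1
  refine ⟨⟨⟨D, hDc⟩, ⟨a, hAD ha⟩⟩, ?_, ?_, ?_⟩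
  · exact isConnected_connectedComponentIn_iff.2 haW
  · refine lt_of_le_of_ne hAD ?_
    intro h
    exact hDA (congrArg (fun K : Hyper X => (K : Set X)) h).symm
  · refine lt_of_le_of_ne (fun x hx => (hDW hx).1) ?_
    intro h
    have : b ∈ D := by
      have h2 : D = (B : Set X) := congrArg (fun K : Hyper X => (K : Set X)) h
      rw [h2]; exact hb1
    exact hbW (hDW this)

/-- Order arcs. -/
lemma exists_order_arc {X : Type*} [MetricSpace X] [CompactSpace X] {C : Hyper X}
    (hC : C ∈ CSet X) {p : X} (hp : p ∈ C) :
    ∃ E : ℝ → Hyper X, Continuous E ∧ E 0 = {p} ∧ E 1 = C ∧ (∀ t, E t ∈ CSet X) ∧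
      (∀ t, p ∈ E t) ∧ ∀ t, E t ≤ C := by
  have : Nonempty X := ⟨p⟩
  obtain ⟨w, hwc, hw⟩ := exists_whitney X
  set P : Set (Hyper X) := {A | A ∈ CSet X ∧ {p} ≤ A ∧ A ≤ C} with hP
  have hPc : IsClosed P := by
    refine isClosed_CSet.inter (IsClosed.inter ?_ ?_)
    · exact isClosed_hle.preimage (f := fun A : Hyper X => (({p} : Hyper X), A)) (by fun_prop)
    · exact isClosed_hle.preimage (f := fun A : Hyper X => (A, C)) (by fun_prop)
  have hpC : ({p} : Hyper X) ≤ C := by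
    intro x hx
    have : x = p := by simpa using hx
    rw [this]; exact hp
  have hpP : ({p} : Hyper X) ∈ P := ⟨by
    change IsConnected (({p} : Hyper X) : Set X)
    simpa using (isConnected_singleton : IsConnected ({p} : Set X)), le_rfl, hpC⟩
  have hCP : C ∈ P := ⟨hC, hpC, le_rfl⟩
  obtain ⟨M, hM, -⟩ := IsChain.exists_maxChain (α := P) (r := (· ≤ ·)) (c := ∅) (by simp [IsChain])
  set 𝓛 : Set (Hyper X) := Subtype.val '' M with h𝓛
  have hLP : 𝓛 ⊆ P := by rintro _ ⟨A, -, rfl⟩; exact A.2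
  have hLchain : ∀ A ∈ 𝓛, ∀ B ∈ 𝓛, A ≤ B ∨ B ≤ A := by
    rintro _ ⟨A, hA, rfl⟩ _ ⟨B, hB, rfl⟩
    exact hM.1.total hA hB
  have hLmax : ∀ D ∈ P, (∀ A ∈ 𝓛, A ≤ D ∨ D ≤ A) → D ∈ 𝓛 := by
    intro D hD h
    have hch : IsChain (· ≤ ·) (insert (⟨D, hD⟩ : P) M) := by
      refine hM.1.insert ?_
      intro b hb _
      rcases h b ⟨b, hb, rfl⟩ with h | h
      · right; exact h
      · left; exact h
    have := hM.2 hch (subset_insert _ _)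
    exact ⟨⟨D, hD⟩, by rw [this]; exact mem_insert _ _, rfl⟩
  have hLclosed : IsClosed 𝓛 := by
    rw [← closure_subset_iff_isClosed]
    intro D hD
    refine hLmax D (hPc.closure_subset_iff.2 hLP hD) ?_
    intro A hA
    have : 𝓛 ⊆ {B | A ≤ B ∨ B ≤ A} := fun B hB => hLchain A hA B hB
    have hcl : IsClosed {B : Hyper X | A ≤ B ∨ B ≤ A} := by
      refine IsClosed.union ?_ ?_
      · exact isClosed_hle.preimage (f := fun B : Hyper X => (A, B)) (by fun_prop)
      · exact isClosed_hle.preimage (f := fun B : Hyper X => (B, A)) (by fun_prop)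
    exact hcl.closure_subset_iff.2 this hD
  have hpL : ({p} : Hyper X) ∈ 𝓛 := hLmax _ hpP fun A hA => Or.inr (hLP hA).2.1
  have hCL : C ∈ 𝓛 := hLmax _ hCP fun A hA => Or.inl (hLP hA).2.2
  have hLcomp : IsCompact 𝓛 := hLclosed.isCompact
  -- the image of the chain is an interval
  have himg : Icc (w {p}) (w C) ⊆ w '' 𝓛 := by
    intro s hs
    by_contra hsn
    have hL1 : IsCompact (𝓛 ∩ {A | w A ≤ s}) :=
      hLcomp.inter_right (isClosed_le hwc continuous_const)
    have hL2 : IsCompact (𝓛 ∩ {A | s ≤ w A}) :=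
      hLcomp.inter_right (isClosed_le continuous_const hwc)
    obtain ⟨A, hA, hAmax⟩ := hL1.exists_isMaxOn ⟨_, hpL, hs.1⟩ hwc.continuousOn
    obtain ⟨B, hB, hBmin⟩ := hL2.exists_isMinOn ⟨_, hCL, hs.2⟩ hwc.continuousOn
    have hAs : w A < s := lt_of_le_of_ne hA.2 fun h => hsn ⟨A, hA.1, h⟩
    have hBs : s < w B := lt_of_le_of_ne hB.2 fun h => hsn ⟨B, hB.1, h.symm⟩
    have hAB : A < B := by
      rcases hLchain A hA.1 B hB.1 with h | h
      · refine lt_of_le_of_ne h ?_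
        rintro rfl
        linarith
      · have := hw.monotone h
        linarith
    obtain ⟨D, hDC, hAD, hDB⟩ := exists_between_continua (hLP hA.1).1 (hLP hB.1).1 hAB
    have hDP : D ∈ P := ⟨hDC, (hLP hA.1).2.1.trans hAD.le, hDB.le.trans (hLP hB.1).2.2⟩
    have hwAD := hw hAD
    have hwDB := hw hDB
    have hD : D ∈ 𝓛 := by
      refine hLmax D hDP fun F hF => ?_
      rcases le_total (w F) s with h | h
      · left
        have h1 : w F ≤ w A := hAmax ⟨hF, h⟩
        rcases hLchain F hF A hA.1 with h2 | h2
        · exact h2.trans hAD.le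
        · rcases eq_or_lt_of_le h2 with h3 | h3
          · rw [← h3]; exact hAD.le
          · have := hw h3
            linarith
      · right
        have h1 : w B ≤ w F := hBmin ⟨hF, h⟩
        rcases hLchain F hF B hB.1 with h2 | h2
        · rcases eq_or_lt_of_le h2 with h3 | h3
          · rw [h3]; exact hDB.le
          · have := hw h3
            linarith
        · exact hDB.le.trans h2
    rcases le_total (w D) s with h | h
    · have h1 : w D ≤ w A := hAmax ⟨hD, h⟩
      linarith
    · have h1 : w B ≤ w D := hBmin ⟨hD, h⟩
      linarith
  have : CompactSpace 𝓛 := isCompact_iff_compactSpace.1 hLcomp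
  have hinj : ∀ A ∈ 𝓛, ∀ B ∈ 𝓛, w A = w B → A = B := by
    intro A hA B hB h
    rcases hLchain A hA B hB with h1 | h1
    · rcases eq_or_lt_of_le h1 with h2 | h2
      · exact h2
      · have := hw h2; linarith
    · rcases eq_or_lt_of_le h1 with h2 | h2
      · exact h2.symm
      · have := hw h2; linarith
  have hwle : w {p} ≤ w C := hw.monotone hpC
  set φ : 𝓛 → Icc (w {p}) (w C) := fun A =>
    ⟨w A, hw.monotone (hLP A.2).2.1, hw.monotone (hLP A.2).2.2⟩ with hφ
  have hφc : Continuous φ := (hwc.comp continuous_subtype_val).subtype_mk _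
  have hφi : Function.Injective φ := by
    intro A B h
    exact Subtype.ext (hinj _ A.2 _ B.2 (congrArg Subtype.val h))
  have hφs : Function.Surjective φ := by
    rintro ⟨s, hs⟩
    obtain ⟨A, hA, rfl⟩ := himg hs
    exact ⟨⟨A, hA⟩, rfl⟩
  let e : 𝓛 ≃ₜ Icc (w {p}) (w C) :=
    Continuous.homeoOfEquivCompactToT2 (f := Equiv.ofBijective φ ⟨hφi, hφs⟩) hφc
  have he : ∀ A, e A = φ A := fun A => rfl
  let r : ℝ → Icc (w {p}) (w C) := fun t => projIcc _ _ hwle (w {p} + t * (w C - w {p}))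
  have hr : Continuous r := continuous_projIcc.comp (by fun_prop)
  refine ⟨fun t => (e.symm (r t) : Hyper X), ?_, ?_, ?_, ?_, ?_, ?_⟩
  · exact continuous_subtype_val.comp (e.symm.continuous.comp hr)
  · have : e.symm (r 0) = ⟨{p}, hpL⟩ := by
      rw [e.symm_apply_eq, he]
      apply Subtype.ext
      simp [r, hφ]
    simp only [this]
  · have : e.symm (r 1) = ⟨C, hCL⟩ := by
      rw [e.symm_apply_eq, he]
      apply Subtype.ext
      simp [r, hφ]
    simp only [this]
  · intro t; exact (hLP (e.symm (r t)).2).1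
  · intro t
    have := (hLP (e.symm (r t)).2).2.1
    exact this (by simp)
  · intro t; exact (hLP (e.symm (r t)).2).2.2

end CBU


namespace CBU

/-! ### Charts and nowhere dense continua -/

/-- `p` is the centre of an `n`-dimensional chart. -/
def IsEuc {X : Type*} [TopologicalSpace X] (n : ℕ) (p : X) : Prop :=
  ∃ ψ : (Fin n → ℝ) → X, IsOpenEmbedding ψ ∧ ψ 0 = p

lemma isEuc_of_chart {X : Type*} [TopologicalSpace X] {n : ℕ} {ψ : (Fin n → ℝ) → X}
    (hψ : IsOpenEmbedding ψ) (y : Fin n → ℝ) : IsEuc n (ψ y) :=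
  ⟨fun z => ψ (z + y), hψ.comp (Homeomorph.addRight y).isOpenEmbedding, by simp⟩

lemma exists_chart_in {X : Type*} [TopologicalSpace X] {n : ℕ} (hE : PiEuclidean X n) {V : Set X}
    (hV : IsOpen V) (hne : V.Nonempty) :
    ∃ ψ : (Fin n → ℝ) → X, IsOpenEmbedding ψ ∧ range ψ ⊆ V := by
  obtain ⟨𝓤, h1, h2⟩ := hE
  obtain ⟨U, hU, hUV⟩ := h2 V hV hne
  obtain ⟨hUo, -, ⟨e⟩⟩ := h1 U hU
  refine ⟨Subtype.val ∘ e.symm, hUo.isOpenEmbedding_subtypeVal.comp e.symm.isOpenEmbedding, ?_⟩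
  rintro _ ⟨y, rfl⟩
  exact hUV (e.symm y).2

lemma one_lt_rank {n : ℕ} (hn : 2 ≤ n) : 1 < Module.rank ℝ (Fin n → ℝ) := by
  rw [rank_fin_fun]
  exact_mod_cast (by omega : 1 < n)

lemma remove_ball {X : Type*} [MetricSpace X] {n : ℕ} (hn : 2 ≤ n) {ψ : (Fin n → ℝ) → X}
    (hψ : IsOpenEmbedding ψ) {Y : Set X} (hYc : IsClosed Y) (hY : IsPreconnected Y)
    {y : Fin n → ℝ} {r : ℝ} (hr : 0 < r) (hsub : ψ '' closedBall y r ⊆ Y) :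
    IsConnected (Y \ ψ '' ball y r) := by
  have hSphere := isConnected_sphere (one_lt_rank hn) y hr.le
  have hS : IsConnected (ψ '' sphere y r) := hSphere.image _ hψ.continuous.continuousOn
  have hSub : ψ '' sphere y r ⊆ Y \ ψ '' ball y r := by
    rintro _ ⟨z, hz, rfl⟩
    refine ⟨hsub ⟨z, sphere_subset_closedBall hz, rfl⟩, ?_⟩
    rintro ⟨z', hz', h⟩
    rw [hψ.injective h] at hz'
    have h1 : dist z y < r := hz'
    have h2 : dist z y = r := hz
    linarith
  have hDo : IsOpen (ψ '' ball y r) := hψ.isOpenMap _ isOpen_ball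
  have hDc : IsClosed (Y \ ψ '' ball y r) := hYc.sdiff hDo
  have hBc : IsClosed (ψ '' closedBall y r) :=
    ((isCompact_closedBall y r).image hψ.continuous).isClosed
  have key : ∀ t t' : Set X, IsClosed t → IsClosed t' → Y \ ψ '' ball y r ⊆ t ∪ t' →
      ((Y \ ψ '' ball y r) ∩ t').Nonempty → ψ '' sphere y r ⊆ t →
      ((Y \ ψ '' ball y r) ∩ (t ∩ t')).Nonempty := by
    intro t t' ht ht' hcov hne hSt
    have h := isPreconnected_closed_iff.1 hY (((Y \ ψ '' ball y r) ∩ t) ∪ ψ '' closedBall y r)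
      ((Y \ ψ '' ball y r) ∩ t') ((hDc.inter ht).union hBc) (hDc.inter ht') ?_ ?_ ?_
    · obtain ⟨x, hxY, hx1, hx2⟩ := h
      refine ⟨x, hx2.1, ?_, hx2.2⟩
      rcases hx1 with h1 | ⟨z, hz, rfl⟩
      · exact h1.2
      · apply hSt
        refine ⟨z, ?_, rfl⟩
        have h1 : dist z y ≤ r := hz
        have h2 : ¬ dist z y < r := fun h => hx2.1.2 ⟨z, h, rfl⟩
        exact le_antisymm h1 (not_lt.1 h2)
    · intro x hx
      by_cases hxD : x ∈ ψ '' ball y r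
      · left; right
        exact image_mono ball_subset_closedBall hxD
      · rcases hcov ⟨hx, hxD⟩ with h | h
        · left; left; exact ⟨⟨hx, hxD⟩, h⟩
        · right; exact ⟨⟨hx, hxD⟩, h⟩
    · exact ⟨ψ y, hsub ⟨y, mem_closedBall_self hr.le, rfl⟩,
        Or.inr ⟨y, mem_closedBall_self hr.le, rfl⟩⟩
    · obtain ⟨x, hx⟩ := hne
      exact ⟨x, hx.1.1, hx⟩
  refine ⟨hS.nonempty.mono hSub, ?_⟩
  rw [isPreconnected_closed_iff]
  intro t t' ht ht' hcov hne hne'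
  by_contra hcon
  have hSd : (ψ '' sphere y r) ∩ (t ∩ t') = ∅ := by
    rw [← not_nonempty_iff_eq_empty]
    intro h
    exact hcon (h.mono (inter_subset_inter_left _ hSub))
  rcases isPreconnected_iff_subset_of_disjoint_closed.1 hS.isPreconnected t t' ht ht'
    (hSub.trans hcov) hSd with h | h
  · exact hcon (key t t' ht ht' hcov hne' h)
  · rw [inter_comm t t'] at hcon
    rw [union_comm] at hcov
    exact hcon (key t' t ht' ht hcov hne h)

lemma exists_thin_continuum {X : Type*} [MetricSpace X] [CompactSpace X] {n : ℕ} (hn : 2 ≤ n)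
    (hE : PiEuclidean X n) {C₀ : Hyper X} (hC₀ : C₀ ∈ CSet X) {T : Set X} (hT : T.Finite)
    (hTC : T ⊆ C₀) :
    ∃ C ∈ CSet X, C ≤ C₀ ∧ T ⊆ (C : Set X) ∧ interior (C : Set X) = ∅ := by
  have : Nonempty X := ⟨C₀.nonempty.some⟩
  obtain ⟨w, hwc, hw⟩ := exists_whitney X
  set P : Set (Hyper X) := {A | A ∈ CSet X ∧ A ≤ C₀ ∧ T ⊆ (A : Set X)} with hP
  have hPc : IsClosed P := by
    refine isClosed_CSet.inter (IsClosed.inter ?_ ?_)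
    · exact isClosed_hle.preimage (f := fun A : Hyper X => (A, C₀)) (by fun_prop)
    · have : {A : Hyper X | T ⊆ (A : Set X)} = ⋂ t ∈ T, {A : Hyper X | ({t} : Hyper X) ≤ A} := by
        ext A
        simp only [mem_ofPred_eq, mem_iInter]
        constructor
        · intro h t ht x hx
          have : x = t := by simpa using hx
          rw [this]; exact h ht
        · intro h t ht
          exact h t ht (by simp)
      change IsClosed {A : Hyper X | T ⊆ (A : Set X)}
      rw [this]
      refine isClosed_biInter fun t _ => ?_
      exact isClosed_hle.preimage (f := fun A : Hyper X => (({t} : Hyper X), A)) (by fun_prop)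
  obtain ⟨C, hC, hmin⟩ := hPc.isCompact.exists_isMinOn ⟨C₀, hC₀, le_rfl, hTC⟩ hwc.continuousOn
  refine ⟨C, hC.1, hC.2.1, hC.2.2, ?_⟩
  by_contra hInt
  obtain ⟨ψ, hψ, hr⟩ := exists_chart_in hE isOpen_interior (nonempty_iff_ne_empty.2 hInt)
  have hfin : (ψ ⁻¹' T).Finite := hT.preimage hψ.injective.injOn
  have : Nontrivial (Fin n → ℝ) := by
    have : Nonempty (Fin n) := ⟨⟨0, by omega⟩⟩
    infer_instance
  have hinf : Infinite (Fin n → ℝ) := Module.Free.infinite ℝ (Fin n → ℝ)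
  obtain ⟨y, hy⟩ := hfin.exists_notMem
  obtain ⟨ρ, hρ, hball⟩ := Metric.nhds_basis_closedBall.mem_iff.1
    (hfin.isClosed.isOpen_compl.mem_nhds hy)
  have hsub : ψ '' closedBall y ρ ⊆ (C : Set X) := by
    rintro _ ⟨z, -, rfl⟩
    exact interior_subset (hr ⟨z, rfl⟩)
  have hcon := remove_ball hn hψ C.isCompact.isClosed hC.1.isPreconnected hρ hsub
  have hcomp : IsCompact ((C : Set X) \ ψ '' ball y ρ) :=
    C.isCompact.diff (hψ.isOpenMap _ isOpen_ball)
  let D : Hyper X := ⟨⟨_, hcomp⟩, hcon.nonempty⟩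
  have hDC : D < C := by
    refine lt_of_le_of_ne (fun x hx => hx.1) ?_
    intro h
    have h1 : ψ y ∈ (C : Set X) := hsub ⟨y, mem_closedBall_self hρ.le, rfl⟩
    rw [← h] at h1
    exact h1.2 ⟨y, mem_ball_self hρ, rfl⟩
  have hDP : D ∈ P := by
    refine ⟨hcon, hDC.le.trans hC.2.1, fun t ht => ⟨hC.2.2 ht, ?_⟩⟩
    rintro ⟨z, hz, rfl⟩
    exact hball (ball_subset_closedBall hz) ht
  have h1 : w C ≤ w D := hmin hDP
  have h2 := hw hDC
  linarith

lemma exists_avoiding_continuum {X : Type*} [MetricSpace X] [CompactSpace X] {n : ℕ} (hn : 2 ≤ n)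
    {G : Set X} (hG : IsOpen G) {T : Set X} (hT : T.Finite) (E : Finset X)
    (hEe : ∀ s ∈ E, IsEuc n s) (hET : ∀ s ∈ E, s ∉ T) {C : Hyper X} (hC : C ∈ CSet X)
    (hCG : (C : Set X) ⊆ G) (hTC : T ⊆ (C : Set X)) :
    ∃ C' ∈ CSet X, (C' : Set X) ⊆ G ∧ T ⊆ (C' : Set X) ∧ ∀ s ∈ E, s ∉ (C' : Set X) := by
  classical
  induction E using Finset.induction_on with
  | empty => exact ⟨C, hC, hCG, hTC, by simp⟩
  | insert s E hs ih =>
    obtain ⟨C', h1, h2, h3, h4⟩ := ih (fun t ht => hEe t (Finset.mem_insert_of_mem ht))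
      (fun t ht => hET t (Finset.mem_insert_of_mem ht))
    by_cases hsC : s ∈ (C' : Set X)
    swap
    · refine ⟨C', h1, h2, h3, ?_⟩
      intro t ht
      rcases Finset.mem_insert.1 ht with rfl | ht
      · exact hsC
      · exact h4 t ht
    obtain ⟨ψ, hψ, hψ0⟩ := hEe s (Finset.mem_insert_self _ _)
    have hO : IsOpen (G ∩ (T ∪ (E : Set X))ᶜ) :=
      hG.inter (hT.union E.finite_toSet).isClosed.isOpen_compl
    have hsO : ψ 0 ∈ G ∩ (T ∪ (E : Set X))ᶜ := by
      rw [hψ0]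
      refine ⟨h2 hsC, ?_⟩
      rintro (h | h)
      · exact hET s (Finset.mem_insert_self _ _) h
      · exact hs h
    obtain ⟨ρ, hρ, hball⟩ := Metric.nhds_basis_closedBall.mem_iff.1
      ((hO.preimage hψ.continuous).mem_nhds hsO)
    have hBcomp : IsCompact (ψ '' closedBall 0 ρ) := (isCompact_closedBall _ _).image hψ.continuous
    have hBconn : IsConnected (ψ '' closedBall 0 ρ) :=
      (isConnected_closedBall hρ.le).image _ hψ.continuous.continuousOn
    have hYconn : IsConnected ((C' : Set X) ∪ ψ '' closedBall 0 ρ) :=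
      IsConnected.union ⟨s, hsC, 0, mem_closedBall_self hρ.le, hψ0⟩ h1 hBconn
    have hYcomp := C'.isCompact.union hBcomp
    have hcon := remove_ball hn hψ hYcomp.isClosed hYconn.isPreconnected hρ subset_union_right
    have hcomp : IsCompact (((C' : Set X) ∪ ψ '' closedBall 0 ρ) \ ψ '' ball 0 ρ) :=
      hYcomp.diff (hψ.isOpenMap _ isOpen_ball)
    refine ⟨⟨⟨_, hcomp⟩, hcon.nonempty⟩, hcon, ?_, ?_, ?_⟩
    · rintro x ⟨hx | ⟨z, hz, rfl⟩, -⟩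
      · exact h2 hx
      · exact (hball hz).1
    · intro t ht
      refine ⟨Or.inl (h3 ht), ?_⟩
      rintro ⟨z, hz, rfl⟩
      exact (hball (ball_subset_closedBall hz)).2 (Or.inl ht)
    · intro t ht hmem
      rcases Finset.mem_insert.1 ht with rfl | ht
      · exact hmem.2 ⟨0, mem_ball_self hρ, hψ0⟩
      · rcases hmem.1 with h | ⟨z, hz, rfl⟩
        · exact h4 t ht h
        · exact (hball hz).2 (Or.inr ht)

end CBU


namespace CBU

/-! ### Nets and stars -/

/-- A system of nets and stars avoiding the finite set `E`. -/
structure Sys (X : Type*) [MetricSpace X] (n : ℕ) (E : Finset X) where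
  P : ℕ → Finset X
  δ : ℕ → ℝ
  St : ℕ → X → ℝ → Hyper X
  δ_pos : ∀ m, 0 < δ m
  δ_le : ∀ m, δ m ≤ (1 / 2 : ℝ) ^ m / 256
  net : ∀ m y, ∃ p ∈ P m, dist p y < δ m
  disj : ∀ m m' p, p ∈ P m → p ∈ P m' → m = m'
  euc : ∀ m, ∀ p ∈ P m, IsEuc n p
  cont : ∀ m, ∀ p ∈ P m, Continuous (St m p)
  zero : ∀ m, ∀ p ∈ P m, St m p 0 = {p}
  conn : ∀ m, ∀ p ∈ P m, ∀ t, St m p t ∈ CSet X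
  mem : ∀ m, ∀ p ∈ P m, ∀ t, p ∈ St m p t
  le : ∀ m, ∀ p ∈ P m, ∀ t, St m p t ≤ St m p 1
  sub : ∀ m, ∀ p ∈ P m, (St m p 1 : Set X) ⊆ ball p ((1 / 2 : ℝ) ^ m / 256)
  thin : ∀ m, ∀ p ∈ P m, interior (St m p 1 : Set X) = ∅
  avoid : ∀ m, ∀ p ∈ P m, ∀ s ∈ E, s ∉ St m p 1
  link : ∀ m m' p q, p ∈ P m → q ∈ P m' → m ≤ m' + 1 → m' ≤ m + 1 →
    dist p q < 3 * δ m' + δ m → q ∈ St m p 1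

lemma exists_net {X : Type*} [MetricSpace X] [CompactSpace X] {n : ℕ} (hn : 2 ≤ n)
    (hE : PiEuclidean X n) (B : Finset X) {d : ℝ} (hd : 0 < d) :
    ∃ P : Finset X, (∀ p ∈ P, IsEuc n p ∧ p ∉ B) ∧ ∀ y, ∃ p ∈ P, dist p y < d := by
  have hnt : Nontrivial (Fin n → ℝ) := by
    have : Nonempty (Fin n) := ⟨⟨0, by omega⟩⟩
    infer_instance
  have hdense : ∀ y : X, ∃ p, (IsEuc n p ∧ p ∉ B) ∧ dist p y < d := by
    intro y
    obtain ⟨ψ, hψ, hr⟩ := exists_chart_in hE (isOpen_ball (x := y) (ε := d)) ⟨y, mem_ball_self hd⟩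
    have hfin : (ψ ⁻¹' (B : Set X)).Finite := B.finite_toSet.preimage hψ.injective.injOn
    have : Infinite (Fin n → ℝ) := by
      exact Module.Free.infinite ℝ (Fin n → ℝ)
    obtain ⟨z, hz⟩ := hfin.infinite_compl.nonempty
    exact ⟨ψ z, ⟨isEuc_of_chart hψ z, fun h => hz h⟩, hr ⟨z, rfl⟩⟩
  obtain ⟨t, ht⟩ := (isCompact_univ (X := X)).elim_finite_subcover
    (fun p : {p : X // IsEuc n p ∧ p ∉ B} => ball (p : X) d) (fun _ => isOpen_ball) (by
      intro y _
      obtain ⟨p, hp, hpy⟩ := hdense y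
      exact mem_iUnion.2 ⟨⟨p, hp⟩, by rw [mem_ball']; exact hpy⟩)
  refine ⟨t.map (Function.Embedding.subtype _), ?_, ?_⟩
  · intro p hp
    obtain ⟨q, hq, rfl⟩ := Finset.mem_map.1 hp
    exact q.2
  · intro y
    obtain ⟨p, hp, hy⟩ := mem_iUnion₂.1 (ht (mem_univ y))
    exact ⟨p, Finset.mem_map_of_mem _ hp, by rw [← mem_ball']; exact hy⟩

lemma exists_lebesgue {X : Type*} [MetricSpace X] [CompactSpace X] [LocallyConnectedSpace X]
    {e : ℝ} (he : 0 < e) :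
    ∃ l : ℝ, 0 < l ∧ ∀ p : X, ∃ C ∈ CSet X, ball p l ⊆ (C : Set X) ∧ (C : Set X) ⊆ ball p e := by
  have hO : ∀ p : X, ∃ O : Set X, IsOpen O ∧ p ∈ O ∧ IsConnected O ∧ O ⊆ ball p (e / 4) := by
    intro p
    obtain ⟨O, hO, h⟩ := locallyConnectedSpace_iff_subsets_isOpen_isConnected.1 ‹_› p
      (ball p (e / 4)) (ball_mem_nhds p (by linarith))
    exact ⟨O, h.1, h.2.1, h.2.2, hO⟩
  choose O hO1 hO2 hO3 hO4 using hO
  obtain ⟨l, hl, h⟩ := lebesgue_number_lemma_of_metric (isCompact_univ (X := X)) hO1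
    (fun x _ => mem_iUnion.2 ⟨x, hO2 x⟩)
  refine ⟨l, hl, fun p => ?_⟩
  obtain ⟨q, hq⟩ := h p (mem_univ p)
  have hpq : dist p q < e / 4 := hO4 q (hq (mem_ball_self hl))
  refine ⟨⟨⟨closure (O q), isClosed_closure.isCompact⟩, (hO3 q).nonempty.closure⟩,
    (hO3 q).closure, hq.trans subset_closure, ?_⟩
  intro y hy
  have h1 : y ∈ closedBall q (e / 4) :=
    closure_minimal ((hO4 q).trans ball_subset_closedBall) isClosed_closedBall hy
  have h2 : dist y q ≤ e / 4 := h1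
  rw [mem_ball]
  have := dist_triangle_right y p q
  linarith

lemma exists_sys {X : Type*} [MetricSpace X] [CompactSpace X] [LocallyConnectedSpace X]
    {n : ℕ} (hn : 2 ≤ n) (hE : PiEuclidean X n) (E : Finset X) (hEE : ∀ s ∈ E, IsEuc n s) :
    Nonempty (Sys X n E) := by
  classical
  set e : ℕ → ℝ := fun m => (1 / 2 : ℝ) ^ m / 256 with he
  have hepos : ∀ m, 0 < e m := fun m => by positivity
  choose l hl hlC using fun m => exists_lebesgue (X := X) (hepos m)
  have hd : ∀ m, ∃ d : ℝ, 0 < d ∧ d ≤ e m ∧ ∀ i ≤ m + 1, d ≤ l i / 4 := by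
    intro m
    refine ⟨min (e m) ((Finset.range (m + 2)).inf' ⟨0, by simp⟩ fun i => l i / 4), ?_, ?_, ?_⟩
    · rw [lt_min_iff]
      refine ⟨hepos m, ?_⟩
      refine (Finset.lt_inf'_iff _).2 ?_
      intro i _
      have := hl i
      linarith
    · exact min_le_left _ _
    · intro i hi
      exact (min_le_right _ _).trans (Finset.inf'_le _ (by simp; omega))
  choose d hd0 hde hdl using hd
  choose N hN1 hN2 using fun (B : Finset X) (m : ℕ) => exists_net hn hE B (hd0 m)
  let C : ℕ → Finset X := fun m => Nat.rec E (fun k c => c ∪ N c k) m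
  have hCs : ∀ m, C (m + 1) = C m ∪ N (C m) m := fun m => rfl
  have hCm : Monotone C := monotone_nat_of_le_succ fun m => by
    rw [hCs]; exact Finset.subset_union_left
  set P : ℕ → Finset X := fun m => N (C m) m with hP
  have hPC : ∀ m, P m ⊆ C (m + 1) := fun m => by rw [hCs]; exact Finset.subset_union_right
  have hPE : ∀ m, ∀ p ∈ P m, p ∉ E := fun m p hp hpE =>
    (hN1 _ _ p hp).2 (hCm (Nat.zero_le m) hpE)
  have hlt : ∀ m m' p, p ∈ P m → p ∈ P m' → ¬ m < m' := fun m m' p hp hp' hlt =>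
    (hN1 _ _ p hp').2 (hCm (Nat.succ_le_of_lt hlt) (hPC m hp))
  have hst : ∀ m p, ∃ F : ℝ → Hyper X, p ∈ P m → Continuous F ∧ F 0 = {p} ∧
      (∀ t, F t ∈ CSet X) ∧ (∀ t, p ∈ F t) ∧ (∀ t, F t ≤ F 1) ∧ (F 1 : Set X) ⊆ ball p (e m) ∧
      interior (F 1 : Set X) = ∅ ∧ (∀ s ∈ E, s ∉ F 1) ∧
      ∀ m' q, q ∈ P m' → m ≤ m' + 1 → m' ≤ m + 1 → dist p q < 3 * d m' + d m → q ∈ F 1 := by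
    intro m p
    by_cases hp : p ∈ P m
    swap
    · exact ⟨fun _ => {p}, fun h => absurd h hp⟩
    obtain ⟨D, hD, hD1, hD2⟩ := hlC m p
    set T : Set X := ↑((C (m + 2)).filter fun q => q ∉ E ∧ q ∈ ball p (l m)) with hT
    have hTf : T.Finite := Finset.finite_toSet _
    have hTE : ∀ s ∈ E, s ∉ T := by
      intro s hs hsT
      simp [hT] at hsT
      exact hsT.2.1 hs
    have hTD : T ⊆ D := by
      intro q hq
      simp [hT] at hq
      exact hD1 (by simpa using hq.2.2)
    obtain ⟨D', hD', hD'1, hTD', hD'2⟩ := exists_avoiding_continuum hn (isOpen_ball (x := p) (ε := e m))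
      hTf E hEE hTE hD hD2 hTD
    obtain ⟨D'', hD'', hle, hTD'', hInt⟩ := exists_thin_continuum hn hE hD' hTf hTD'
    have hpT : p ∈ T := by
      simp only [hT, Finset.coe_filter, mem_ofPred_eq]
      exact ⟨hCm (show m + 1 ≤ m + 2 by omega) (hPC m hp), hPE m p hp, mem_ball_self (hl m)⟩
    obtain ⟨F, hF1, hF2, hF3, hF4, hF5, hF6⟩ := exists_order_arc hD'' (hTD'' hpT)
    refine ⟨F, fun _ => ⟨hF1, hF2, hF4, hF5, fun t => hF3 ▸ hF6 t, ?_, ?_, ?_, ?_⟩⟩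
    · rw [hF3]; exact (SetLike.coe_subset_coe.2 hle).trans hD'1
    · rw [hF3]; exact hInt
    · rw [hF3]; exact fun s hs h => hD'2 s hs (hle h)
    · intro m' q hq h1 h2 hdist
      rw [hF3]
      apply hTD''
      simp only [hT, Finset.coe_filter, mem_ofPred_eq]
      refine ⟨hCm (show m' + 1 ≤ m + 2 by omega) (hPC m' hq), hPE m' q hq, ?_⟩
      rw [mem_ball']
      have := hdl m' m h1
      have := hdl m m (by omega)
      linarith
  choose St hSt using hst
  exact ⟨{
    P := P
    δ := d
    St := St
    δ_pos := hd0
    δ_le := hde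
    net := fun m y => hN2 _ m y
    disj := fun m m' p hp hp' =>
      le_antisymm (not_lt.1 (hlt m' m p hp' hp)) (not_lt.1 (hlt m m' p hp hp'))
    euc := fun m p hp => (hN1 _ _ p hp).1
    cont := fun m p hp => (hSt m p hp).1
    zero := fun m p hp => (hSt m p hp).2.1
    conn := fun m p hp => (hSt m p hp).2.2.1
    mem := fun m p hp => (hSt m p hp).2.2.2.1
    le := fun m p hp => (hSt m p hp).2.2.2.2.1
    sub := fun m p hp => (hSt m p hp).2.2.2.2.2.1
    thin := fun m p hp => (hSt m p hp).2.2.2.2.2.2.1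
    avoid := fun m p hp => (hSt m p hp).2.2.2.2.2.2.2.1
    link := fun m m' p q hp hq h1 h2 h3 => (hSt m p hp).2.2.2.2.2.2.2.2 m' q hq h1 h2 h3 }⟩

end CBU


namespace CBU

/-! ### The union map -/

lemma mem_sup' {X ι : Type*} [MetricSpace X] {F : Finset ι} (hF : F.Nonempty) (f : ι → Hyper X)
    (x : X) : x ∈ F.sup' hF f ↔ ∃ v ∈ F, x ∈ f v := by
  classical
  induction hF using Finset.Nonempty.cons_induction with
  | singleton a => simp
  | cons a s ha hs ih =>
    rw [Finset.sup'_cons hs]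
    have : x ∈ f a ⊔ s.sup' hs f ↔ x ∈ f a ∨ x ∈ s.sup' hs f := by
      rw [← SetLike.mem_coe, TopologicalSpace.NonemptyCompacts.coe_sup]
      rfl
    rw [this, ih]
    simp

/-- Clamp to the unit interval. -/
def clamp (t : ℝ) : ℝ := max 0 (min 1 t)

lemma continuous_clamp : Continuous clamp := by unfold clamp; fun_prop

lemma clamp_of_one_le {t : ℝ} (h : 1 ≤ t) : clamp t = 1 := by simp [clamp, h]

lemma clamp_of_nonpos {t : ℝ} (h : t ≤ 0) : clamp t = 0 := by
  unfold clamp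
  exact max_eq_left ((min_le_right _ _).trans h)

lemma clamp_nonneg (t : ℝ) : 0 ≤ clamp t := le_max_left _ _

lemma clamp_le_one (t : ℝ) : clamp t ≤ 1 := max_le zero_le_one (min_le_left _ _)

variable {X : Type*} [MetricSpace X] {n : ℕ} {E : Finset X}

namespace Sys

/-- Vertices of the system. -/
def Valid (S : Sys X n E) (v : ℕ × X) : Prop := v.2 ∈ S.P v.1

/-- The star of a vertex. -/
def star (S : Sys X n E) (v : ℕ × X) (t : ℝ) : Hyper X := S.St v.1 v.2 t

/-- Activity of a vertex. -/
def act (S : Sys X n E) (v : ℕ × X) (A : Hyper X) (τ : NNReal) : ℝ :=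
  min (clamp (2 - infDist v.2 A / S.δ v.1)) (clamp (2 - 2 * |(τ : ℝ) - v.1|))

def Near (S : Sys X n E) (A : Hyper X) (τ : NNReal) (v : ℕ × X) : Prop :=
  S.Valid v ∧ infDist v.2 A < 3 * S.δ v.1 ∧ |(τ : ℝ) - v.1| < 5 / 4

/-- The scale of the core vertices. -/
def cs (τ : NNReal) : ℕ := ⌊(τ : ℝ) + 1 / 2⌋₊

def Core (S : Sys X n E) (A : Hyper X) (τ : NNReal) (v : ℕ × X) : Prop :=
  S.Valid v ∧ infDist v.2 A < S.δ v.1 ∧ v.1 = cs τ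

lemma abs_cs (τ : NNReal) : |(τ : ℝ) - cs τ| ≤ 1 / 2 := by
  have h0 : (0 : ℝ) ≤ τ := τ.2
  have h1 := Nat.floor_le (a := (τ : ℝ) + 1 / 2) (by positivity)
  have h2 := Nat.lt_floor_add_one ((τ : ℝ) + 1 / 2)
  unfold cs
  rw [abs_le]
  constructor <;> linarith

lemma continuous_act (S : Sys X n E) (v : ℕ × X) :
    Continuous fun q : Hyper X × NNReal => S.act v q.1 q.2 := by
  unfold act
  have h1 : Continuous fun q : Hyper X × NNReal => infDist v.2 (q.1 : Set X) :=
    (Metric.lipschitz_infDist_set v.2).continuous.comp continuous_fst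
  refine Continuous.min (continuous_clamp.comp ?_) (continuous_clamp.comp ?_)
  · exact continuous_const.sub (h1.div_const _)
  · fun_prop

lemma act_nonneg (S : Sys X n E) (v : ℕ × X) (A : Hyper X) (τ : NNReal) : 0 ≤ S.act v A τ :=
  le_min (clamp_nonneg _) (clamp_nonneg _)

lemma act_le_one (S : Sys X n E) (v : ℕ × X) (A : Hyper X) (τ : NNReal) : S.act v A τ ≤ 1 :=
  (min_le_left _ _).trans (clamp_le_one _)

lemma act_eq_one (S : Sys X n E) {v : ℕ × X} {A : Hyper X} {τ : NNReal} (h : S.Core A τ v) :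
    S.act v A τ = 1 := by
  have h1 : infDist v.2 (A : Set X) / S.δ v.1 ≤ 1 := by
    rw [div_le_one (S.δ_pos _)]; exact h.2.1.le
  have h2 := abs_cs τ
  rw [← h.2.2] at h2
  unfold act
  rw [clamp_of_one_le (by linarith), clamp_of_one_le (by linarith), min_self]

lemma act_eq_zero_of_dist (S : Sys X n E) {v : ℕ × X} {A : Hyper X} {τ : NNReal}
    (h : 2 * S.δ v.1 ≤ infDist v.2 (A : Set X)) : S.act v A τ = 0 := by
  have h1 : 2 ≤ infDist v.2 (A : Set X) / S.δ v.1 := by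
    rw [le_div_iff₀ (S.δ_pos _)]; exact h
  unfold act
  rw [clamp_of_nonpos (by linarith)]
  exact min_eq_left (clamp_nonneg _)

lemma act_eq_zero_of_scale (S : Sys X n E) {v : ℕ × X} {A : Hyper X} {τ : NNReal}
    (h : 1 ≤ |(τ : ℝ) - v.1|) : S.act v A τ = 0 := by
  unfold act
  rw [clamp_of_nonpos (t := 2 - 2 * |(τ : ℝ) - v.1|) (by linarith)]
  exact min_eq_right (clamp_nonneg _)

lemma Core.near {S : Sys X n E} {v : ℕ × X} {A : Hyper X} {τ : NNReal} (h : S.Core A τ v) :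
    S.Near A τ v := by
  have h2 := abs_cs τ
  rw [← h.2.2] at h2
  have := S.δ_pos v.1
  have := h.2.1
  exact ⟨h.1, by linarith, by linarith⟩

lemma exists_core (S : Sys X n E) {A : Hyper X} (τ : NNReal) {a : X} (ha : a ∈ A) :
    ∃ v, S.Core A τ v ∧ dist v.2 a < S.δ v.1 := by
  obtain ⟨p, hp, hd⟩ := S.net (cs τ) a
  exact ⟨(cs τ, p), ⟨hp, (infDist_le_dist_of_mem ha).trans_lt hd, rfl⟩, hd⟩

lemma Near.link {S : Sys X n E} {v : ℕ × X} {A : Hyper X} {τ : NNReal} (h : S.Near A τ v) :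
    ∃ w, S.Core A τ w ∧ v.2 ∈ S.star w 1 := by
  obtain ⟨a, ha, hda⟩ := (infDist_lt_iff A.nonempty).1 h.2.1
  obtain ⟨w, hw, hwa⟩ := S.exists_core τ ha
  refine ⟨w, hw, ?_⟩
  have h2 := abs_cs τ
  rw [← hw.2.2] at h2
  have h3 := h.2.2
  rw [abs_le] at h2
  rw [abs_lt] at h3
  have e1 : (w.1 : ℝ) < v.1 + 2 := by linarith
  have e2 : (v.1 : ℝ) < w.1 + 2 := by linarith
  have e1' : w.1 < v.1 + 2 := by exact_mod_cast e1
  have e2' : v.1 < w.1 + 2 := by exact_mod_cast e2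
  refine S.link w.1 v.1 w.2 v.2 hw.1 h.1 (by omega) (by omega) ?_
  have := dist_triangle w.2 a v.2
  rw [dist_comm a] at this
  linarith

/-- All valid vertices of scale less than `M`. -/
def verts (S : Sys X n E) (M : ℕ) : Finset (ℕ × X) := by
  classical
  exact (Finset.range M).biUnion fun m => (S.P m).image fun p => (m, p)

lemma mem_verts (S : Sys X n E) {M : ℕ} {v : ℕ × X} :
    v ∈ S.verts M ↔ S.Valid v ∧ v.1 < M := by
  classical
  simp only [verts, Finset.mem_biUnion, Finset.mem_image, Finset.mem_range, Valid]
  constructor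
  · rintro ⟨m, hm, p, hp, rfl⟩
    exact ⟨hp, hm⟩
  · rintro ⟨h1, h2⟩
    exact ⟨v.1, h2, v.2, h1, rfl⟩

/-- The finite set of near vertices. -/
def nearF (S : Sys X n E) (A : Hyper X) (τ : NNReal) : Finset (ℕ × X) := by
  classical
  exact (S.verts (⌊(τ : ℝ)⌋₊ + 3)).filter (S.Near A τ)

lemma Near.lt {S : Sys X n E} {v : ℕ × X} {A : Hyper X} {τ : NNReal} (h : S.Near A τ v) :
    v.1 < ⌊(τ : ℝ)⌋₊ + 3 := by
  have h2 := Nat.lt_floor_add_one (τ : ℝ)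
  have h3 := h.2.2
  rw [abs_lt] at h3
  have : (v.1 : ℝ) < (⌊(τ : ℝ)⌋₊ : ℝ) + 3 := by linarith
  exact_mod_cast this

lemma mem_nearF (S : Sys X n E) {A : Hyper X} {τ : NNReal} {v : ℕ × X} :
    v ∈ S.nearF A τ ↔ S.Near A τ v := by
  classical
  simp only [nearF, Finset.mem_filter, mem_verts]
  exact ⟨fun h => h.2, fun h => ⟨⟨h.1, h.lt⟩, h⟩⟩

lemma nearF_nonempty (S : Sys X n E) (A : Hyper X) (τ : NNReal) : (S.nearF A τ).Nonempty := by
  obtain ⟨a, ha⟩ := A.nonempty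
  obtain ⟨v, hv, -⟩ := S.exists_core τ ha
  exact ⟨v, S.mem_nearF.2 hv.near⟩

/-- Blobs: a parametrized family of sets attached to the vertices. -/
structure Blob (S : Sys X n E) (Z : Type*) [TopologicalSpace Z] where
  H : ℕ × X → ℝ → Z → Hyper X
  cont : ∀ v, S.Valid v → Continuous fun q : ℝ × Z => H v q.1 q.2
  zero : ∀ v, S.Valid v → ∀ z, H v 0 z = {v.2}
  star_le : ∀ v, S.Valid v → ∀ t z, S.star v t ≤ H v t z
  sub : ∀ v, S.Valid v → ∀ t z, 0 ≤ t → t ≤ 1 →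
    (H v t z : Set X) ⊆ ball v.2 ((1 / 2 : ℝ) ^ v.1 / 256)

variable {Z : Type*} [TopologicalSpace Z]

/-- The union map. -/
def union (S : Sys X n E) (B : S.Blob Z) (A : Hyper X) (τ : NNReal) (z : Z) : Hyper X :=
  (S.nearF A τ).sup' (S.nearF_nonempty A τ) fun v => B.H v (S.act v A τ) z

lemma mem_union' (S : Sys X n E) (B : S.Blob Z) {A : Hyper X} {τ : NNReal} {z : Z} {x : X} :
    x ∈ S.union B A τ z ↔ ∃ v, S.Near A τ v ∧ x ∈ B.H v (S.act v A τ) z := by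
  unfold union
  rw [mem_sup']
  simp only [mem_nearF]

lemma core_sub_union (S : Sys X n E) (B : S.Blob Z) {A : Hyper X} {τ : NNReal} {z : Z}
    {v : ℕ × X} (hv : S.Core A τ v) : B.H v 1 z ≤ S.union B A τ z := by
  intro x hx
  refine (S.mem_union' B).2 ⟨v, hv.near, ?_⟩
  rwa [S.act_eq_one hv]

lemma eventually_near (S : Sys X n E) (A₀ : Hyper X) (τ₀ : NNReal) :
    ∀ᶠ q : Hyper X × NNReal in 𝓝 (A₀, τ₀), (∀ v, S.Near A₀ τ₀ v → S.Near q.1 q.2 v) ∧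
      ∀ v, S.Near q.1 q.2 v → ¬ S.Near A₀ τ₀ v → ¬ S.Core q.1 q.2 v ∧ S.act v q.1 q.2 = 0 := by
  classical
  have hi : ∀ v : ℕ × X, Continuous fun q : Hyper X × NNReal => infDist v.2 (q.1 : Set X) :=
    fun v => (Metric.lipschitz_infDist_set v.2).continuous.comp continuous_fst
  have hs : ∀ v : ℕ × X, Continuous fun q : Hyper X × NNReal => |(q.2 : ℝ) - v.1| :=
    fun v => by fun_prop
  have h1 : ∀ᶠ q : Hyper X × NNReal in 𝓝 (A₀, τ₀),
      ∀ v ∈ S.nearF A₀ τ₀, S.Near q.1 q.2 v := by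
    rw [Filter.eventually_all_finset]
    intro v hv
    have hv' := S.mem_nearF.1 hv
    have e1 := ((hi v).tendsto (A₀, τ₀)).eventually_lt_const hv'.2.1
    have e2 := ((hs v).tendsto (A₀, τ₀)).eventually_lt_const hv'.2.2
    filter_upwards [e1, e2] with q hq1 hq2
    exact ⟨hv'.1, hq1, hq2⟩
  have h2 : ∀ᶠ q : Hyper X × NNReal in 𝓝 (A₀, τ₀), (q.2 : ℝ) < τ₀ + 1 := by
    have hc : Continuous fun q : Hyper X × NNReal => (q.2 : ℝ) := by fun_prop
    exact (hc.tendsto (A₀, τ₀)).eventually_lt_const (by simp)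
  have h3 : ∀ᶠ q : Hyper X × NNReal in 𝓝 (A₀, τ₀),
      ∀ v ∈ (S.verts (⌊(τ₀ : ℝ)⌋₊ + 4)).filter (fun v => ¬ S.Near A₀ τ₀ v),
        2 * S.δ v.1 < infDist v.2 (q.1 : Set X) ∨ 1 < |(q.2 : ℝ) - v.1| := by
    rw [Filter.eventually_all_finset]
    intro v hv
    rw [Finset.mem_filter, mem_verts] at hv
    obtain ⟨⟨hval, -⟩, hnn⟩ := hv
    have hδ := S.δ_pos v.1
    by_cases hc : infDist v.2 (A₀ : Set X) < 3 * S.δ v.1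
    · have hc' : ¬ |(τ₀ : ℝ) - v.1| < 5 / 4 := fun h => hnn ⟨hval, hc, h⟩
      have e2 := ((hs v).tendsto (A₀, τ₀)).eventually_const_lt
        (show (1 : ℝ) < |(τ₀ : ℝ) - v.1| by linarith)
      filter_upwards [e2] with q hq
      exact Or.inr hq
    · have e2 := ((hi v).tendsto (A₀, τ₀)).eventually_const_lt
        (show 2 * S.δ v.1 < infDist v.2 (A₀ : Set X) by linarith)
      filter_upwards [e2] with q hq
      exact Or.inl hq
  filter_upwards [h1, h2, h3] with q hq1 hq2 hq3
  refine ⟨fun v hv => hq1 v (S.mem_nearF.2 hv), fun v hv hnv => ?_⟩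
  have hlt : v.1 < ⌊(τ₀ : ℝ)⌋₊ + 4 := by
    have h2 := Nat.lt_floor_add_one (τ₀ : ℝ)
    have h3 := hv.2.2
    rw [abs_lt] at h3
    have : (v.1 : ℝ) < (⌊(τ₀ : ℝ)⌋₊ : ℝ) + 4 := by linarith
    exact_mod_cast this
  have hδ := S.δ_pos v.1
  rcases hq3 v (Finset.mem_filter.2 ⟨S.mem_verts.2 ⟨hv.1, hlt⟩, hnv⟩) with h | h
  · exact ⟨fun hc => by have := hc.2.1; linarith, S.act_eq_zero_of_dist h.le⟩
  · refine ⟨fun hc => ?_, S.act_eq_zero_of_scale h.le⟩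
    have h2 := abs_cs q.2
    rw [← hc.2.2] at h2
    linarith

lemma continuous_union (S : Sys X n E) (B : S.Blob Z) :
    Continuous fun q : (Hyper X × NNReal) × Z => S.union B q.1.1 q.1.2 q.2 := by
  rw [continuous_iff_continuousAt]
  rintro ⟨⟨A₀, τ₀⟩, z₀⟩
  have hev : (fun q : (Hyper X × NNReal) × Z => S.union B q.1.1 q.1.2 q.2)
      =ᶠ[𝓝 ((A₀, τ₀), z₀)] fun q => (S.nearF A₀ τ₀).sup' (S.nearF_nonempty A₀ τ₀)
        fun v => B.H v (S.act v q.1.1 q.1.2) q.2 := by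
    have h := (continuous_fst (X := Hyper X × NNReal) (Y := Z)).continuousAt
      (x := ((A₀, τ₀), z₀)) |>.eventually (S.eventually_near A₀ τ₀)
    filter_upwards [h] with q hq
    obtain ⟨h1, h2⟩ := hq
    apply SetLike.ext
    intro x
    rw [mem_union', mem_sup']
    simp only [mem_nearF]
    constructor
    · rintro ⟨v, hv, hx⟩
      by_cases hv0 : S.Near A₀ τ₀ v
      · exact ⟨v, hv0, hx⟩
      · rw [(h2 v hv hv0).2, B.zero v hv.1] at hx
        have hx' : x = v.2 := by simpa using hx
        obtain ⟨w, hw, hvw⟩ := hv.link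
        refine ⟨w, ?_, ?_⟩
        · by_contra hnw
          exact (h2 w hw.near hnw).1 hw
        · rw [S.act_eq_one hw, hx']
          exact B.star_le w hw.1 1 q.2 hvw
    · rintro ⟨v, hv, hx⟩
      exact ⟨v, h1 v hv, hx⟩
  refine ContinuousAt.congr ?_ hev.symm
  refine Continuous.continuousAt ?_
  refine Continuous.finset_sup'_apply (s := S.nearF A₀ τ₀) _ (f := fun v (q : (Hyper X × NNReal) × Z) => B.H v (S.act v q.1.1 q.1.2) q.2) ?_
  intro v hv
  exact (B.cont v (S.mem_nearF.1 hv).1).comp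
    (((S.continuous_act v).comp continuous_fst).prodMk continuous_snd)

lemma dist_union_le (S : Sys X n E) (B : S.Blob Z) (A : Hyper X) (τ : NNReal) (z : Z) :
    dist (S.union B A τ z) A ≤ (2 : ℝ) ^ (-(τ : ℝ)) / 16 := by
  have hpow : ∀ m : ℕ, |(τ : ℝ) - m| < 2 → (1 / 2 : ℝ) ^ m ≤ 4 * (2 : ℝ) ^ (-(τ : ℝ)) := by
    intro m hm
    have h1 : (1 / 2 : ℝ) ^ m = (2 : ℝ) ^ (-(m : ℝ)) := by
      rw [Real.rpow_neg (by norm_num), Real.rpow_natCast, one_div, inv_pow]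
    have h2 : 4 * (2 : ℝ) ^ (-(τ : ℝ)) = (2 : ℝ) ^ (2 - (τ : ℝ)) := by
      rw [sub_eq_add_neg, Real.rpow_add (by norm_num)]
      norm_num
    rw [h1, h2]
    apply Real.rpow_le_rpow_of_exponent_le (by norm_num)
    rw [abs_lt] at hm
    linarith
  have hp0 : 0 < (2 : ℝ) ^ (-(τ : ℝ)) := by positivity
  rw [Metric.NonemptyCompacts.dist_eq]
  refine hausdorffDist_le_of_mem_dist (by positivity) ?_ ?_
  · intro x hx
    obtain ⟨v, hv, hxv⟩ := (S.mem_union' B).1 hx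
    have h1 := B.sub v hv.1 _ z (S.act_nonneg v A τ) (S.act_le_one v A τ) hxv
    rw [mem_ball] at h1
    obtain ⟨a, ha, hda⟩ := (infDist_lt_iff A.nonempty).1 hv.2.1
    refine ⟨a, ha, ?_⟩
    have h2 := hpow v.1 (by have := hv.2.2; linarith)
    have h3 := S.δ_le v.1
    have := dist_triangle x v.2 a
    linarith
  · intro a ha
    obtain ⟨v, hv, hd⟩ := S.exists_core τ ha
    refine ⟨v.2, S.core_sub_union B hv (B.star_le v hv.1 1 z (S.mem v.1 v.2 hv.1 1)), ?_⟩
    have h2 := hpow v.1 (by have := hv.near.2.2; linarith)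
    have h3 := S.δ_le v.1
    rw [dist_comm]
    linarith

/-- The blob consisting of the stars. -/
def starBlob (S : Sys X n E) : S.Blob Unit where
  H v t _ := S.star v t
  cont v hv := (S.cont v.1 v.2 hv).comp continuous_fst
  zero v hv _ := S.zero v.1 v.2 hv
  star_le _ _ _ _ := le_rfl
  sub v hv t _ _ _ := (SetLike.coe_subset_coe.2 (S.le v.1 v.2 hv t)).trans (S.sub v.1 v.2 hv)

/-- The nerve-like skeleton. -/
def skel (S : Sys X n E) (A : Hyper X) (τ : NNReal) : Hyper X := S.union S.starBlob A τ ()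

lemma mem_skel (S : Sys X n E) {A : Hyper X} {τ : NNReal} {x : X} :
    x ∈ S.skel A τ ↔ ∃ v, S.Near A τ v ∧ x ∈ S.star v (S.act v A τ) :=
  S.mem_union' S.starBlob

lemma near_mem_skel (S : Sys X n E) {A : Hyper X} {τ : NNReal} {v : ℕ × X} (hv : S.Near A τ v) :
    v.2 ∈ S.skel A τ := S.mem_skel.2 ⟨v, hv, S.mem v.1 v.2 hv.1 _⟩

lemma core_sub_skel (S : Sys X n E) {A : Hyper X} {τ : NNReal} {v : ℕ × X} (hv : S.Core A τ v) :
    S.star v 1 ≤ S.skel A τ := S.core_sub_union S.starBlob hv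

lemma skel_le_union (S : Sys X n E) (B : S.Blob Z) {A : Hyper X} {τ : NNReal} {z : Z} :
    S.skel A τ ≤ S.union B A τ z := by
  intro x hx
  obtain ⟨v, hv, hx⟩ := S.mem_skel.1 hx
  exact (S.mem_union' B).2 ⟨v, hv, B.star_le v hv.1 _ z hx⟩

lemma skel_conn (S : Sys X n E) {A : Hyper X} (hA : A ∈ CSet X) (τ : NNReal) :
    S.skel A τ ∈ CSet X := by
  have hAc : IsConnected (A : Set X) := hA
  obtain ⟨a₀, ha₀⟩ := A.nonempty
  obtain ⟨w₀, hw₀, hd₀⟩ := S.exists_core τ ha₀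
  set N : Set X := (S.skel A τ : Set X) with hN
  have hw₀N : w₀.2 ∈ N := S.near_mem_skel hw₀.near
  set D := connectedComponentIn N w₀.2 with hD
  have step : ∀ C : Set X, IsPreconnected C → C ⊆ N → ∀ x ∈ C, x ∈ D → C ⊆ D := by
    intro C hC hCN x hx hxD
    rw [hD, connectedComponentIn_eq hxD]
    exact hC.subset_connectedComponentIn hx hCN
  have hlink : ∀ w w', S.Core A τ w → S.Core A τ w' →
      dist w.2 w'.2 < 2 * S.δ (cs τ) → w.2 ∈ D → w'.2 ∈ D := by
    intro w w' hw hw' hd hwD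
    have h1 : w'.2 ∈ S.star w 1 := by
      refine S.link w.1 w'.1 w.2 w'.2 hw.1 hw'.1 ?_ ?_ ?_
      · rw [hw.2.2, hw'.2.2]; omega
      · rw [hw.2.2, hw'.2.2]; omega
      · rw [hw.2.2, hw'.2.2]
        have := S.δ_pos (cs τ)
        linarith
    exact step _ (S.conn w.1 w.2 hw.1 1).isPreconnected (S.core_sub_skel hw) w.2
      (S.mem w.1 w.2 hw.1 1) hwD h1
  have hcore : ∀ w, S.Core A τ w → w.2 ∈ D := by
    by_contra hcon
    push Not at hcon
    obtain ⟨w₁, hw₁, hw₁D⟩ := hcon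
    obtain ⟨a₁, ha₁, hd₁⟩ := (infDist_lt_iff A.nonempty).1 hw₁.2.1
    let U : Set X := ⋃ w ∈ {w | S.Core A τ w ∧ w.2 ∈ D}, ball w.2 (S.δ (cs τ))
    let U' : Set X := ⋃ w ∈ {w | S.Core A τ w ∧ w.2 ∉ D}, ball w.2 (S.δ (cs τ))
    have hU : IsOpen U := isOpen_biUnion fun _ _ => isOpen_ball
    have hU' : IsOpen U' := isOpen_biUnion fun _ _ => isOpen_ball
    have hcov : (A : Set X) ⊆ U ∪ U' := by
      intro a ha
      obtain ⟨w, hw, hd⟩ := S.exists_core τ ha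
      rw [hw.2.2, ← mem_ball'] at hd
      by_cases hwD : w.2 ∈ D
      · left; exact mem_iUnion₂.2 ⟨w, ⟨hw, hwD⟩, hd⟩
      · right; exact mem_iUnion₂.2 ⟨w, ⟨hw, hwD⟩, hd⟩
    have hne0 : ((A : Set X) ∩ U).Nonempty := by
      refine ⟨a₀, ha₀, mem_iUnion₂.2 ⟨w₀, ⟨hw₀, mem_connectedComponentIn hw₀N⟩, ?_⟩⟩
      rw [mem_ball', ← hw₀.2.2]; exact hd₀
    have hne1 : ((A : Set X) ∩ U').Nonempty := by
      refine ⟨a₁, ha₁, mem_iUnion₂.2 ⟨w₁, ⟨hw₁, hw₁D⟩, ?_⟩⟩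
      rw [mem_ball', ← hw₁.2.2]; exact hd₁
    obtain ⟨x, -, hx, hx'⟩ := hAc.isPreconnected U U' hU hU' hcov hne0 hne1
    obtain ⟨w, ⟨hw, hwD⟩, hwx⟩ := mem_iUnion₂.1 hx
    obtain ⟨w', ⟨hw', hwD'⟩, hwx'⟩ := mem_iUnion₂.1 hx'
    apply hwD'
    refine hlink w w' hw hw' ?_ hwD
    rw [mem_ball] at hwx hwx'
    have := dist_triangle_left w.2 w'.2 x
    linarith
  have hall : N ⊆ D := by
    intro x hx
    obtain ⟨v, hv, hxv⟩ := S.mem_skel.1 hx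
    obtain ⟨w, hw, hvw⟩ := hv.link
    have h1 : v.2 ∈ D := step _ (S.conn w.1 w.2 hw.1 1).isPreconnected (S.core_sub_skel hw) w.2
      (S.mem w.1 w.2 hw.1 1) (hcore w hw) hvw
    refine step _ (S.conn v.1 v.2 hv.1 (S.act v A τ)).isPreconnected ?_ v.2
      (S.mem v.1 v.2 hv.1 _) h1 hxv
    intro y hy
    exact S.mem_skel.2 ⟨v, hv, hy⟩
  have hND : N = D := hall.antisymm (connectedComponentIn_subset _ _)
  refine ⟨⟨_, hw₀N⟩, ?_⟩
  change IsPreconnected N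
  rw [hND]
  exact isPreconnected_connectedComponentIn

end Sys

end CBU


namespace CBU

/-! ### Coding points of the Hilbert cube by compact subsets of the interval -/

abbrev Cantor := ℕ → Fin 2

/-- Truncated binary expansions. -/
def dig (s : ℝ) (d : Cantor) : ℝ := ∑' j : ℕ, clamp (2 - j * s) * Real.ofDigitsTerm d j

lemma dig_term_nonneg (s : ℝ) (d : Cantor) (j : ℕ) :
    0 ≤ clamp (2 - j * s) * Real.ofDigitsTerm d j :=
  mul_nonneg (clamp_nonneg _) Real.ofDigitsTerm_nonneg

lemma dig_term_le (s : ℝ) (d : Cantor) (j : ℕ) :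
    clamp (2 - j * s) * Real.ofDigitsTerm d j ≤ Real.ofDigitsTerm d j :=
  mul_le_of_le_one_left Real.ofDigitsTerm_nonneg (clamp_le_one _)

lemma dig_nonneg (s : ℝ) (d : Cantor) : 0 ≤ dig s d := tsum_nonneg fun _ => dig_term_nonneg _ _ _

lemma dig_le_one (s : ℝ) (d : Cantor) : dig s d ≤ 1 := by
  refine le_trans ?_ (Real.ofDigits_le_one d)
  refine Summable.tsum_le_tsum (fun j => dig_term_le s d j) ?_ Real.summable_ofDigitsTerm
  exact Summable.of_nonneg_of_le (fun j => dig_term_nonneg s d j) (fun j => dig_term_le s d j)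
    Real.summable_ofDigitsTerm

lemma continuous_dig : Continuous fun q : ℝ × Cantor => dig q.1 q.2 := by
  unfold dig
  refine continuous_tsum (u := fun j : ℕ => (1 / 2 : ℝ) ^ j) ?_
    (summable_geometric_of_lt_one (by norm_num) (by norm_num)) ?_
  · intro j
    refine (continuous_clamp.comp (by fun_prop)).mul ?_
    unfold Real.ofDigitsTerm
    refine Continuous.mul ?_ continuous_const
    exact (continuous_of_discreteTopology (f := fun e : Fin 2 => ((e : ℕ) : ℝ))).comp
      ((continuous_apply j).comp continuous_snd)
  · rintro j ⟨s, d⟩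
    rw [Real.norm_of_nonneg (dig_term_nonneg _ _ _)]
    refine (dig_term_le _ _ _).trans (Real.ofDigitsTerm_le.trans ?_)
    have : ((2 : ℕ) - 1 : ℝ) * (((2 : ℕ) : ℝ) ^ (j + 1))⁻¹ = (1 / 2 : ℝ) ^ j * (1 / 2) := by
      rw [← pow_succ, one_div, inv_pow]; norm_num
    rw [this]
    have : (0 : ℝ) < (1 / 2 : ℝ) ^ j := by positivity
    linarith

lemma dig_zero_surj {y : ℝ} (hy : y ∈ Icc (0 : ℝ) 1) : ∃ d, dig 0 d = y := by
  obtain ⟨d, -, hd⟩ := Real.ofDigits_SurjOn (b := 2) (by norm_num) hy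
  refine ⟨d, ?_⟩
  rw [← hd]
  unfold dig Real.ofDigits
  congr 1
  ext j
  rw [clamp_of_one_le (by norm_num), one_mul]

lemma dig_countable {s : ℝ} (hs : 0 < s) : (range (dig s)).Countable := by
  obtain ⟨N, hN⟩ := exists_nat_ge (2 / s)
  rw [div_le_iff₀ hs] at hN
  have h : range (dig s) ⊆ range fun e : Fin N → Fin 2 =>
      ∑ j : Fin N, clamp (2 - (j : ℕ) * s) * (((e j : ℕ) : ℝ) * (((2 : ℕ) : ℝ) ^ ((j : ℕ) + 1))⁻¹) := by
    rintro _ ⟨d, rfl⟩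
    refine ⟨fun j => d j, ?_⟩
    unfold dig
    rw [tsum_eq_sum (s := Finset.range N)]
    · rw [Finset.sum_range]
      rfl
    · intro j hj
      rw [Finset.mem_range, not_lt] at hj
      have : (N : ℝ) ≤ j := by exact_mod_cast hj
      have h2 : (N : ℝ) * s ≤ j * s := mul_le_mul_of_nonneg_right this hs.le
      rw [clamp_of_nonpos (by linarith), zero_mul]
  exact (countable_range _).mono h

/-- Block scales. -/
def cc (k : ℕ) : ℝ := (1 / 4 : ℝ) ^ (k + 1)

lemma cc_pos (k : ℕ) : 0 < cc k := by unfold cc; positivity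

lemma cc_lt {k k' : ℕ} (h : k < k') : 4 * cc k' ≤ cc k := by
  unfold cc
  have h1 : (1 / 4 : ℝ) ^ (k' + 1) ≤ (1 / 4 : ℝ) ^ (k + 1 + 1) :=
    pow_le_pow_of_le_one (by norm_num) (by norm_num) (by omega)
  rw [pow_succ _ (k + 1)] at h1
  linarith

lemma cc_le (k : ℕ) : 4 * cc k ≤ 1 := by
  unfold cc
  have h1 : (1 / 4 : ℝ) ^ k ≤ 1 := pow_le_one₀ (by norm_num) (by norm_num)
  rw [pow_succ]
  linarith

lemma cc_inj {k k' : ℕ} {a a' : ℝ} (h : cc k * a = cc k' * a') (ha : 1 ≤ a) (ha4 : a < 4)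
    (ha' : 1 ≤ a') (ha4' : a' < 4) : k = k' ∧ a = a' := by
  have key : ∀ k k' : ℕ, ∀ a a' : ℝ, 1 ≤ a → a' < 4 → cc k * a = cc k' * a' → ¬ k < k' := by
    intro k k' a a' ha ha' h hlt
    have h1 := cc_lt hlt
    have h2 : cc k * 1 ≤ cc k * a := mul_le_mul_of_nonneg_left ha (cc_pos k).le
    have h3 : cc k' * a' < cc k' * 4 := mul_lt_mul_of_pos_left ha' (cc_pos k')
    linarith
  have hk : k = k' := le_antisymm (not_lt.1 (key k' k a' a ha' ha4 h.symm))
    (not_lt.1 (key k k' a a' ha ha4' h))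
  subst hk
  exact ⟨rfl, mul_left_cancel₀ (cc_pos k).ne' h⟩

/-- The block elements. -/
def blk (x : Iinf) (s : ℝ) (k : ℕ) (b : Fin 2) (d : Cantor) : ℝ :=
  if b = 0 then 1 + (x k : ℝ) / 2 else 2 + dig s d

lemma blk_mem (x : Iinf) (s : ℝ) (k : ℕ) (b : Fin 2) (d : Cantor) :
    (1 ≤ blk x s k b d ∧ blk x s k b d ≤ 3 / 2) ∨ (2 ≤ blk x s k b d ∧ blk x s k b d ≤ 3) := by
  unfold blk
  split_ifs
  · left
    have h0 : (0 : ℝ) ≤ x k := (x k).2.1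
    have h1 : (x k : ℝ) ≤ 1 := (x k).2.2
    constructor <;> linarith
  · right
    have h0 := dig_nonneg s d
    have h1 := dig_le_one s d
    constructor <;> linarith

lemma blk_bd (x : Iinf) (s : ℝ) (k : ℕ) (b : Fin 2) (d : Cantor) :
    1 ≤ blk x s k b d ∧ blk x s k b d ≤ 3 := by
  rcases blk_mem x s k b d with h | h
  · exact ⟨h.1, by linarith [h.2]⟩
  · exact ⟨by linarith [h.1], h.2⟩

/-- Indicator of `k` being the first nonzero digit of `y`. -/
def fst1 (k : ℕ) (y : Cantor) : ℝ := ((y k : ℕ) : ℝ) * ∏ j ∈ Finset.range k, (1 - ((y j : ℕ) : ℝ))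

lemma continuous_fst1 (k : ℕ) : Continuous (fst1 k) := by
  have h : ∀ j, Continuous fun y : Cantor => ((y j : ℕ) : ℝ) := fun j =>
    (continuous_of_discreteTopology (f := fun e : Fin 2 => ((e : ℕ) : ℝ))).comp
      (continuous_apply j)
  unfold fst1
  exact (h k).mul (continuous_finsetProd _ fun j _ => continuous_const.sub (h j))

lemma fst1_eq {k : ℕ} {y : Cantor} (h : y k = 1) (h' : ∀ j < k, y j = 0) (i : ℕ) :
    fst1 i y = if i = k then 1 else 0 := by
  unfold fst1
  rcases lt_trichotomy i k with hi | hi | hi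
  · rw [h' i hi, if_neg hi.ne]; simp
  · subst hi
    rw [if_pos rfl, h, Finset.prod_eq_one]
    · simp
    · intro j hj
      rw [h' j (Finset.mem_range.1 hj)]; simp
  · rw [if_neg hi.ne', Finset.prod_eq_zero (i := k) (Finset.mem_range.2 hi), mul_zero]
    rw [h]; simp

lemma fst1_zero {y : Cantor} (h : ∀ j, y j = 0) (i : ℕ) : fst1 i y = 0 := by
  unfold fst1; rw [h i]; simp

lemma fst1_cases (y : Cantor) : (∀ j, y j = 0) ∨ ∃ k, y k = 1 ∧ ∀ j < k, y j = 0 := by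
  classical
  by_cases h : ∃ k, y k = 1
  · right
    refine ⟨Nat.find h, Nat.find_spec h, fun j hj => ?_⟩
    have := Nat.find_min h hj
    generalize y j = e at *
    fin_cases e <;> simp_all
  · left
    intro j
    have : ¬ y j = 1 := fun hj => h ⟨j, hj⟩
    generalize y j = e at *
    fin_cases e <;> simp_all

lemma fst1_abs (i : ℕ) (y : Cantor) : |fst1 i y| ≤ 1 := by
  rcases fst1_cases y with h | ⟨k, h, h'⟩
  · rw [fst1_zero h]; simp
  · rw [fst1_eq h h']; split_ifs <;> simp

abbrev CodeDom := Cantor × Fin 2 × Cantor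

/-- Parametrization of the code set. -/
def val (φ : ℕ → Iinf → ℝ) (x : Iinf) (q : CodeDom) : ℝ :=
  ∑' k, fst1 k q.1 * (cc k * blk x (φ k x) k q.2.1 q.2.2)

lemma val_of_zero (φ : ℕ → Iinf → ℝ) (x : Iinf) {q : CodeDom} (h : ∀ j, q.1 j = 0) :
    val φ x q = 0 := by
  unfold val
  simp [fst1_zero h]

lemma val_of_first (φ : ℕ → Iinf → ℝ) (x : Iinf) {q : CodeDom} {k : ℕ} (h : q.1 k = 1)
    (h' : ∀ j < k, q.1 j = 0) : val φ x q = cc k * blk x (φ k x) k q.2.1 q.2.2 := by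
  unfold val
  rw [tsum_eq_single k]
  · rw [fst1_eq h h', if_pos rfl, one_mul]
  · intro i hi
    rw [fst1_eq h h', if_neg hi, zero_mul]

lemma continuous_val {φ : ℕ → Iinf → ℝ} (hφ : ∀ k, Continuous (φ k)) :
    Continuous fun p : Iinf × CodeDom => val φ p.1 p.2 := by
  unfold val
  refine continuous_tsum (u := fun k : ℕ => (1 / 4 : ℝ) ^ k) ?_
    (summable_geometric_of_lt_one (by norm_num) (by norm_num)) ?_
  · intro k
    refine ((continuous_fst1 k).comp (by fun_prop)).mul (continuous_const.mul ?_)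
    have h1 : Continuous fun p : Iinf × CodeDom => 1 + ((p.1 k : unitInterval) : ℝ) / 2 := by
      fun_prop
    have h2 : Continuous fun p : Iinf × CodeDom => 2 + dig (φ k p.1) p.2.2.2 :=
      continuous_const.add (continuous_dig.comp
        (((hφ k).comp continuous_fst).prodMk (by fun_prop)))
    have hb : ∀ b0 : Fin 2, IsClopen {p : Iinf × CodeDom | p.2.2.1 = b0} := fun b0 =>
      (isClopen_discrete {b0}).preimage
        (f := fun p : Iinf × CodeDom => p.2.2.1) (by fun_prop)
    unfold blk
    refine Continuous.if ?_ h1 h2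
    intro a ha
    rw [(hb 0).frontier_eq] at ha
    exact absurd ha (notMem_empty _)
  · rintro k ⟨x, q⟩
    rw [Real.norm_eq_abs, abs_mul]
    have h1 := fst1_abs k q.1
    have h2 := blk_bd x (φ k x) k q.2.1 q.2.2
    have h3 := cc_pos k
    have h4 : |cc k * blk x (φ k x) k q.2.1 q.2.2| ≤ cc k * 3 := by
      rw [abs_mul, abs_of_pos h3, abs_of_nonneg (by linarith [h2.1])]
      exact mul_le_mul_of_nonneg_left h2.2 h3.le
    calc _ ≤ 1 * (cc k * 3) := mul_le_mul h1 h4 (abs_nonneg _) zero_le_one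
      _ ≤ _ := by
        have : (0 : ℝ) < (1 / 4) ^ k := by positivity
        unfold cc; rw [pow_succ]; linarith

/-- The coding map. -/
def code (φ : ℕ → Iinf → ℝ) (hφ : ∀ k, Continuous (φ k)) (x : Iinf) : Hyper ℝ :=
  (⊤ : TopologicalSpace.NonemptyCompacts CodeDom).map (val φ x)
    ((continuous_val hφ).comp (by fun_prop : Continuous fun q : CodeDom => (x, q))) ⊔ {1}

lemma continuous_code {φ : ℕ → Iinf → ℝ} (hφ : ∀ k, Continuous (φ k)) :
    Continuous (code φ hφ) := by
  unfold code
  refine Continuous.sup ?_ continuous_const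
  exact Continuous.nonemptyCompacts_map' (g := fun x q => val φ x q) continuous_const
    (continuous_val hφ)

lemma mem_code {φ : ℕ → Iinf → ℝ} {hφ : ∀ k, Continuous (φ k)} {x : Iinf} {y : ℝ} :
    y ∈ code φ hφ x ↔ y = 0 ∨ y = 1 ∨ ∃ k b d, y = cc k * blk x (φ k x) k b d := by
  have h0 : y ∈ code φ hφ x ↔ (∃ q, val φ x q = y) ∨ y = 1 := by
    rw [← SetLike.mem_coe, code, TopologicalSpace.NonemptyCompacts.coe_sup,
      TopologicalSpace.NonemptyCompacts.coe_map]
    simp [or_comm]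
  rw [h0]
  constructor
  · rintro (⟨q, rfl⟩ | h)
    · rcases fst1_cases q.1 with h | ⟨k, h, h'⟩
      · left; exact val_of_zero φ x h
      · right; right
        exact ⟨k, q.2.1, q.2.2, val_of_first φ x h h'⟩
    · right; left; exact h
  · rintro (h | h | ⟨k, b, d, h⟩)
    · left
      exact ⟨(fun _ => 0, 0, fun _ => 0), by rw [val_of_zero φ x (fun _ => rfl), h]⟩
    · right; exact h
    · left
      refine ⟨(fun j => if j = k then 1 else 0, b, d), ?_⟩
      rw [val_of_first φ x (k := k) (by simp) (fun j hj => by simp [hj.ne]), h]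

lemma exists_code (F : ℕ → Set Iinf) (hF : ∀ k, IsClosed (F k)) :
    ∃ S : Iinf → Hyper ℝ, Continuous S ∧ Function.Injective S ∧
      (∀ x, (S x : Set ℝ) ⊆ Icc 0 1) ∧ (∀ x, (1 : ℝ) ∈ S x) ∧
      (∀ x, x ∉ ⋃ k, F k → (S x : Set ℝ).Countable) ∧
      ∀ x ∈ ⋃ k, F k, ∃ a b c d : ℝ, 0 < a ∧ a < b ∧ b < c ∧ c < d ∧ d ≤ 1 ∧
        Icc b c ⊆ (S x : Set ℝ) ∧ Disjoint (S x : Set ℝ) (Ioo a b) ∧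
        Disjoint (S x : Set ℝ) (Ioo c d) := by
  have hφ : ∀ k, ∃ φ : Iinf → ℝ, Continuous φ ∧ (∀ x, 0 ≤ φ x) ∧ ∀ x, φ x = 0 ↔ x ∈ F k := by
    intro k
    let _ := TopologicalSpace.metrizableSpaceMetric Iinf
    rcases (F k).eq_empty_or_nonempty with h | h
    · exact ⟨fun _ => 1, continuous_const, fun _ => zero_le_one, fun x => by simp [h]⟩
    · exact ⟨fun x => infDist x (F k), continuous_infDist_pt _, fun _ => infDist_nonneg,
        fun x => ((hF k).mem_iff_infDist_zero h).symm⟩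
  choose φ hφc hφ0 hφz using hφ
  refine ⟨code φ hφc, continuous_code hφc, ?_, ?_, ?_, ?_, ?_⟩
  · intro x x' h
    ext k
    have h1 : cc k * blk x (φ k x) k 0 (fun _ => 0) ∈ code φ hφc x' := by
      rw [← h, mem_code]
      exact Or.inr (Or.inr ⟨_, _, _, rfl⟩)
    have hb := blk_bd x (φ k x) k 0 (fun _ => 0)
    have h0 : (0 : ℝ) ≤ x k := (x k).2.1
    have h1' : (x k : ℝ) ≤ 1 := (x k).2.2
    have hbe : blk x (φ k x) k 0 (fun _ => 0) = 1 + (x k : ℝ) / 2 := by simp [blk]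
    have hc := cc_pos k
    have hc' := cc_le k
    rw [hbe, mem_code] at h1
    rcases h1 with h1 | h1 | ⟨k', b, d, h1⟩
    · have : 0 < cc k * (1 + (x k : ℝ) / 2) := by positivity
      linarith
    · nlinarith
    · have hb' := blk_bd x' (φ k' x') k' b d
      obtain ⟨rfl, h2⟩ := cc_inj h1 (by linarith) (by linarith) hb'.1 (by linarith)
      unfold blk at h2
      split_ifs at h2
      · linarith
      · have := dig_nonneg (φ k x') d
        linarith
  · intro x y hy
    rcases mem_code.1 hy with h | h | ⟨k, b, d, h⟩
    · rw [h]; simp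
    · rw [h]; simp
    · have hb := blk_bd x (φ k x) k b d
      have hc := cc_pos k
      have hc' := cc_le k
      rw [h]
      constructor
      · exact mul_nonneg hc.le (by linarith)
      · nlinarith
  · intro x
    exact mem_code.2 (Or.inr (Or.inl rfl))
  · intro x hx
    have hpos : ∀ k, 0 < φ k x := fun k => lt_of_le_of_ne (hφ0 k x) fun h =>
      hx (mem_iUnion.2 ⟨k, (hφz k x).1 h.symm⟩)
    have hsub : (code φ hφc x : Set ℝ) ⊆ {0, 1} ∪ ⋃ k, ((fun y => cc k * y) ''
        ({1 + (x k : ℝ) / 2} ∪ (fun y => 2 + y) '' range (dig (φ k x)))) := by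
      intro y hy
      rcases mem_code.1 hy with h | h | ⟨k, b, d, h⟩
      · left; simp [h]
      · left; simp [h]
      · right
        refine mem_iUnion.2 ⟨k, _, ?_, h.symm⟩
        unfold blk
        split_ifs
        · left; rfl
        · right; exact ⟨_, ⟨d, rfl⟩, rfl⟩
    refine Countable.mono hsub ?_
    refine ((Set.toFinite _).countable).union (countable_iUnion fun k => Countable.image ?_ _)
    exact (countable_singleton _).union ((dig_countable (hpos k)).image _)
  · intro x hx
    obtain ⟨k, hk⟩ := mem_iUnion.1 hx
    have hc := cc_pos k
    have hc' := cc_le k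
    have gap : ∀ u v : ℝ, 1 ≤ u → v ≤ 4 → (v ≤ 2 ∨ 3 ≤ u) → 3 / 2 ≤ u →
        Disjoint (code φ hφc x : Set ℝ) (Ioo (cc k * u) (cc k * v)) := by
      intro u v hu hv huv hu'
      rw [Set.disjoint_left]
      rintro y hy ⟨hy1, hy2⟩
      have e1 : y = cc k * (y / cc k) := by field_simp
      set a := y / cc k with ha
      rw [e1] at hy1 hy2
      have a1 : u < a := lt_of_mul_lt_mul_left hy1 hc.le
      have a2 : a < v := lt_of_mul_lt_mul_left hy2 hc.le
      rcases mem_code.1 hy with h | h | ⟨k', b, d, h⟩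
      · nlinarith
      · nlinarith
      · rw [e1] at h
        have hb := blk_bd x (φ k' x) k' b d
        obtain ⟨rfl, h2⟩ := cc_inj h (by linarith) (by linarith) hb.1 (by linarith)
        rcases blk_mem x (φ k x) k b d with h3 | h3
        · linarith [h3.2]
        · rcases huv with h4 | h4
          · linarith [h3.1]
          · linarith [h3.2]
    refine ⟨cc k * (3 / 2), cc k * 2, cc k * 3, cc k * 4, by positivity, by linarith, by linarith,
      by linarith, by linarith, ?_, gap _ _ (by norm_num) (by norm_num) (by norm_num) (by norm_num),
      gap _ _ (by norm_num) (by norm_num) (by norm_num) (by norm_num)⟩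
    rintro y ⟨hy1, hy2⟩
    have e1 : y = cc k * (y / cc k) := by field_simp
    set a := y / cc k with ha
    rw [e1] at hy1 hy2
    have a1 : 2 ≤ a := le_of_mul_le_mul_left hy1 hc
    have a2 : a ≤ 3 := le_of_mul_le_mul_left hy2 hc
    obtain ⟨d, hd⟩ := dig_zero_surj (y := a - 2) ⟨by linarith, by linarith⟩
    refine mem_code.2 (Or.inr (Or.inr ⟨k, 1, d, ?_⟩))
    rw [(hφz k x).2 hk]
    unfold blk
    rw [if_neg (by decide), hd, e1]
    congr 1
    ring

end CBU


namespace CBU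

/-! ### Decorations: small balls with marked segments -/

variable {X : Type*} [MetricSpace X] {n : ℕ} {E : Finset X}

lemma IsMeagre.interior_eq {X : Type*} [TopologicalSpace X] [BaireSpace X] {s : Set X}
    (h : IsMeagre s) : interior s = ∅ :=
  interior_eq_empty_iff_dense_compl.2 (dense_of_mem_residual h)

namespace Sys

lemma star_meagre (S : Sys X n E) {v : ℕ × X} (hv : S.Valid v) :
    IsMeagre (S.star v 1 : Set X) := by
  apply IsNowhereDense.isMeagre
  rw [(S.star v 1).isCompact.isClosed.isNowhereDense_iff]
  exact S.thin v.1 v.2 hv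

/-- Union of all the stars of scale less than `M`. -/
def Gam (S : Sys X n E) (M : ℕ) : Set X := ⋃ v ∈ (S.verts M : Set (ℕ × X)), (S.star v 1 : Set X)

lemma isClosed_Gam (S : Sys X n E) (M : ℕ) : IsClosed (S.Gam M) :=
  (S.verts M).finite_toSet.isClosed_biUnion fun _ _ => (S.star _ 1).isCompact.isClosed

lemma Gam_meagre (S : Sys X n E) (M : ℕ) : IsMeagre (S.Gam M) :=
  isMeagre_biUnion (S.verts M).finite_toSet.countable fun _ hv =>
    S.star_meagre (S.mem_verts.1 hv).1

lemma star_sub_Gam (S : Sys X n E) {M : ℕ} {v : ℕ × X} (hv : S.Valid v) (h : v.1 < M) :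
    (S.star v 1 : Set X) ⊆ S.Gam M :=
  subset_biUnion_of_mem (u := fun v => (S.star v 1 : Set X))
    (show v ∈ (S.verts M : Set (ℕ × X)) from S.mem_verts.2 ⟨hv, h⟩)

/-- Decorations of a system. -/
structure Dec (S : Sys X n E) where
  ψ : ℕ × X → (Fin n → ℝ) → X
  u : ℕ × X → (Fin n → ℝ)
  θ : ℕ × X → ℝ
  emb : ∀ v, S.Valid v → IsOpenEmbedding (ψ v)
  center : ∀ v, S.Valid v → ψ v 0 = v.2
  norm_u : ∀ v, S.Valid v → ‖u v‖ = 1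
  θ_pos : ∀ v, S.Valid v → 0 < θ v
  θ_lt : ∀ v, S.Valid v → θ v < 1
  ball_sub : ∀ v, S.Valid v → ψ v '' closedBall 0 1 ⊆ ball v.2 ((1 / 2 : ℝ) ^ v.1 / 256)
  disj : ∀ v w, S.Valid v → S.Valid w → v.1 ≤ w.1 + 3 → w.1 ≤ v.1 + 3 →
    (ψ v '' closedBall 0 1 ∩ ψ w '' closedBall 0 1).Nonempty → v = w
  seg : ∀ v w, S.Valid v → S.Valid w → w.1 ≤ v.1 + 3 → ∀ t, θ v ≤ t → t ≤ 1 →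
    ψ v (t • u v) ∉ S.star w 1

lemma exists_sep {X : Type*} [MetricSpace X] (s : Finset X) :
    ∃ κ : ℝ, 0 < κ ∧ ∀ x ∈ s, ∀ y ∈ s, x ≠ y → 2 * κ ≤ dist x y := by
  classical
  by_cases h : (s.offDiag).Nonempty
  · refine ⟨(s.offDiag.inf' h fun p => dist p.1 p.2) / 2, ?_, ?_⟩
    · refine half_pos ((Finset.lt_inf'_iff _).2 fun p hp => ?_)
      exact dist_pos.2 (Finset.mem_offDiag.1 hp).2.2
    · intro x hx y hy hxy
      have := Finset.inf'_le (fun p : X × X => dist p.1 p.2)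
        (show (x, y) ∈ s.offDiag from Finset.mem_offDiag.2 ⟨hx, hy, hxy⟩)
      linarith
  · refine ⟨1, one_pos, fun x hx y hy hxy => ?_⟩
    exact absurd ⟨(x, y), Finset.mem_offDiag.2 ⟨hx, hy, hxy⟩⟩ h

lemma exists_chart (hn : 2 ≤ n) {p : X} [BaireSpace X] (hp : IsEuc n p) {r : ℝ} (hr : 0 < r)
    {Γ : Set X} (hΓc : IsClosed Γ) (hΓ : IsMeagre Γ) :
    ∃ (ψ : (Fin n → ℝ) → X) (u : Fin n → ℝ) (θ : ℝ), IsOpenEmbedding ψ ∧ ψ 0 = p ∧ ‖u‖ = 1 ∧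
      0 < θ ∧ θ < 1 ∧ ψ '' closedBall 0 1 ⊆ ball p r ∧
      ∀ t, θ ≤ t → t ≤ 1 → ψ (t • u) ∉ Γ := by
  have hnt : Nontrivial (Fin n → ℝ) := by
    have : Nonempty (Fin n) := ⟨⟨0, by omega⟩⟩
    infer_instance
  obtain ⟨ψ₀, hψ₀, h0⟩ := hp
  have hnhds : ψ₀ ⁻¹' ball p r ∈ 𝓝 (0 : Fin n → ℝ) :=
    hψ₀.continuous.continuousAt.preimage_mem_nhds (by rw [h0]; exact ball_mem_nhds p hr)
  obtain ⟨R, hR, hRsub⟩ := Metric.mem_nhds_iff.1 hnhds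
  have hopen : IsOpen (ball (0 : Fin n → ℝ) R \ {0}) := isOpen_ball.sdiff isClosed_singleton
  have hne : (ball (0 : Fin n → ℝ) R \ {0}).Nonempty := by
    obtain ⟨z, hz⟩ := exists_norm_eq (Fin n → ℝ) (half_pos hR).le
    refine ⟨z, ?_, ?_⟩
    · rw [mem_ball_zero_iff, hz]; linarith
    · intro h
      rw [mem_singleton_iff] at h
      rw [h, norm_zero] at hz
      linarith
  have hex : ∃ y ∈ ball (0 : Fin n → ℝ) R \ {0}, ψ₀ y ∉ Γ := by
    by_contra hcon
    push Not at hcon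
    have h1 : ψ₀ '' (ball (0 : Fin n → ℝ) R \ {0}) ⊆ interior Γ := by
      apply interior_maximal _ (hψ₀.isOpenMap _ hopen)
      rintro _ ⟨y, hy, rfl⟩
      exact hcon y hy
    rw [IsMeagre.interior_eq hΓ] at h1
    exact (hne.image ψ₀).ne_empty (subset_empty_iff.1 h1)
  obtain ⟨y, ⟨hyR, hy0⟩, hyΓ⟩ := hex
  have hy0' : y ≠ 0 := hy0
  have hyn : 0 < ‖y‖ := norm_pos_iff.2 hy0'
  rw [mem_ball_zero_iff] at hyR
  set ψ : (Fin n → ℝ) → X := fun z => ψ₀ (‖y‖ • z) with hψ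
  have hemb : IsOpenEmbedding ψ :=
    hψ₀.comp (Homeomorph.smulOfNeZero ‖y‖ hyn.ne').isOpenEmbedding
  set u := ‖y‖⁻¹ • y with hu
  have hun : ‖u‖ = 1 := by
    rw [hu, norm_smul, norm_inv, norm_norm, inv_mul_cancel₀ hyn.ne']
  have hψu : ψ u = ψ₀ y := by
    rw [hψ]
    simp only [hu]
    rw [smul_smul, mul_inv_cancel₀ hyn.ne', one_smul]
  have hcont : Continuous fun t : ℝ => ψ (t • u) := hemb.continuous.comp (by fun_prop)
  have hn1 : (fun t : ℝ => ψ (t • u)) ⁻¹' Γᶜ ∈ 𝓝 (1 : ℝ) := by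
    refine hcont.continuousAt.preimage_mem_nhds ?_
    rw [one_smul, hψu]
    exact hΓc.isOpen_compl.mem_nhds hyΓ
  obtain ⟨η, hη, hηsub⟩ := Metric.mem_nhds_iff.1 hn1
  refine ⟨ψ, u, max (1 / 2) (1 - η / 2), hemb, by simp [hψ, h0], hun,
    lt_of_lt_of_le (by norm_num) (le_max_left _ _), max_lt (by norm_num) (by linarith), ?_, ?_⟩
  · rintro _ ⟨z, hz, rfl⟩
    rw [mem_closedBall_zero_iff] at hz
    apply hRsub
    rw [mem_ball_zero_iff, norm_smul, norm_norm]
    nlinarith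
  · intro t ht1 ht2
    have h2 := (le_max_right _ _).trans ht1
    apply hηsub
    rw [mem_ball, Real.dist_eq, abs_lt]
    constructor <;> linarith

lemma exists_dec [CompactSpace X] (hn : 2 ≤ n) (S : Sys X n E) : Nonempty S.Dec := by
  classical
  choose κ hκ0 hκ using fun m : ℕ => exists_sep ((S.verts (m + 4)).image Prod.snd)
  have key : ∀ v : ℕ × X, ∃ (ψ : (Fin n → ℝ) → X) (u : Fin n → ℝ) (θ : ℝ), S.Valid v →
      IsOpenEmbedding ψ ∧ ψ 0 = v.2 ∧ ‖u‖ = 1 ∧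
      0 < θ ∧ θ < 1 ∧ ψ '' closedBall 0 1 ⊆ ball v.2 (min (κ v.1) ((1 / 2 : ℝ) ^ v.1 / 256)) ∧
      ∀ t, θ ≤ t → t ≤ 1 → ψ (t • u) ∉ S.Gam (v.1 + 4) := by
    intro v
    by_cases hv : S.Valid v
    · obtain ⟨ψ, u, θ, h⟩ := exists_chart hn (S.euc v.1 v.2 hv)
        (r := min (κ v.1) ((1 / 2 : ℝ) ^ v.1 / 256)) (lt_min (hκ0 _) (by positivity))
        (S.isClosed_Gam (v.1 + 4)) (S.Gam_meagre _)
      exact ⟨ψ, u, θ, fun _ => h⟩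
    · exact ⟨fun _ => v.2, 0, 0, fun h => absurd h hv⟩
  choose ψ u θ h using key
  exact ⟨{
    ψ := ψ
    u := u
    θ := θ
    emb := fun v hv => (h v hv).1
    center := fun v hv => (h v hv).2.1
    norm_u := fun v hv => (h v hv).2.2.1
    θ_pos := fun v hv => (h v hv).2.2.2.1
    θ_lt := fun v hv => (h v hv).2.2.2.2.1
    ball_sub := fun v hv => (h v hv).2.2.2.2.2.1.trans (ball_subset_ball (min_le_right _ _))
    disj := by
      rintro v w hv hw h1 h2 ⟨x, hxv, hxw⟩
      have hxv' := (h v hv).2.2.2.2.2.1 hxv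
      have hxw' := (h w hw).2.2.2.2.2.1 hxw
      rw [mem_ball] at hxv' hxw'
      have e1 := hxv'.trans_le (min_le_left _ _)
      have e2 := hxw'.trans_le (min_le_left _ _)
      have hvw : v.2 = w.2 := by
        by_contra hne
        have hm : ∀ (m : ℕ) (z : ℕ × X), S.Valid z → z.1 < m + 4 →
            z.2 ∈ (S.verts (m + 4)).image Prod.snd := fun m z hz hlt =>
          Finset.mem_image_of_mem _ (S.mem_verts.2 ⟨hz, hlt⟩)
        have k1 := hκ v.1 v.2 (hm _ v hv (by omega)) w.2 (hm _ w hw (by omega)) hne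
        have k2 := hκ w.1 v.2 (hm _ v hv (by omega)) w.2 (hm _ w hw (by omega)) hne
        have := dist_triangle_left v.2 w.2 x
        linarith
      exact Prod.ext (S.disj v.1 w.1 v.2 hv (hvw ▸ hw)) hvw
    seg := fun v w hv hw hle t ht1 ht2 hmem =>
      (h v hv).2.2.2.2.2.2 t ht1 ht2 (S.star_sub_Gam hw (by omega) hmem) }⟩

end Sys

end CBU


namespace CBU

/-! ### The decorated union map -/

variable {X : Type*} [MetricSpace X] {n : ℕ} {E : Finset X}

lemma frontier_meets {X : Type*} [TopologicalSpace X] {t s : Set X} (ht : IsPreconnected t)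
    (h1 : (t ∩ s).Nonempty) (h2 : (t ∩ sᶜ).Nonempty) : (t ∩ frontier s).Nonempty := by
  by_contra hcon
  rw [not_nonempty_iff_eq_empty] at hcon
  have hsub : t ⊆ interior s ∪ (closure s)ᶜ := by
    intro x hx
    by_contra h
    rw [mem_union, not_or, notMem_compl_iff] at h
    have : x ∈ t ∩ frontier s := ⟨hx, h.2, h.1⟩
    rw [hcon] at this
    exact this
  obtain ⟨a, hat, has⟩ := h1
  obtain ⟨b, hbt, hbs⟩ := h2
  have ha : a ∈ interior s := by
    rcases hsub hat with h | h
    · exact h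
    · exact absurd (subset_closure has) h
  have hb : b ∈ (closure s)ᶜ := by
    rcases hsub hbt with h | h
    · exact absurd (interior_subset h) hbs
    · exact h
  obtain ⟨c, -, hc1, hc2⟩ := ht _ _ isOpen_interior isClosed_closure.isOpen_compl hsub
    ⟨a, hat, ha⟩ ⟨b, hbt, hb⟩
  exact hc2 (subset_closure (interior_subset hc1))

/-- The unit sphere as a member of the hyperspace. -/
def usph (hn : 2 ≤ n) : Hyper (Fin n → ℝ) :=
  ⟨⟨sphere 0 1, isCompact_sphere _ _⟩, (isConnected_sphere (one_lt_rank hn) 0 zero_le_one).nonempty⟩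

lemma mem_usph {hn : 2 ≤ n} {z : Fin n → ℝ} : z ∈ usph hn ↔ ‖z‖ = 1 := by
  change z ∈ sphere 0 1 ↔ _
  rw [mem_sphere_zero_iff_norm]

namespace Sys

variable {S : Sys X n E}

namespace Dec

/-- Radii. -/
def hh (D : S.Dec) (v : ℕ × X) (s : ℝ) : ℝ := D.θ v + (1 - D.θ v) * clamp s

lemma hh_ge (D : S.Dec) {v : ℕ × X} (hv : S.Valid v) (s : ℝ) : D.θ v ≤ D.hh v s := by
  have := D.θ_lt v hv
  have := clamp_nonneg s
  unfold hh
  nlinarith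

lemma hh_le (D : S.Dec) {v : ℕ × X} (hv : S.Valid v) (s : ℝ) : D.hh v s ≤ 1 := by
  have := D.θ_lt v hv
  have := clamp_le_one s
  unfold hh
  nlinarith

lemma hh_one (D : S.Dec) (v : ℕ × X) : D.hh v 1 = 1 := by
  unfold hh
  rw [clamp_of_one_le le_rfl]; ring

lemma clamp_of_mem {s : ℝ} (h : s ∈ Icc (0 : ℝ) 1) : clamp s = s := by
  unfold clamp
  rw [min_eq_right h.2, max_eq_right h.1]

lemma hh_lt_iff (D : S.Dec) {v : ℕ × X} (hv : S.Valid v) {s t : ℝ} (hs : s ∈ Icc (0 : ℝ) 1)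
    (ht : t ∈ Icc (0 : ℝ) 1) : D.hh v s < D.hh v t ↔ s < t := by
  have h := D.θ_lt v hv
  unfold hh
  rw [clamp_of_mem hs, clamp_of_mem ht, add_lt_add_iff_left]
  exact mul_lt_mul_iff_right₀ (by linarith)

lemma hh_inj (D : S.Dec) {v : ℕ × X} (hv : S.Valid v) {s t : ℝ} (hs : s ∈ Icc (0 : ℝ) 1)
    (ht : t ∈ Icc (0 : ℝ) 1) (h : D.hh v s = D.hh v t) : s = t := by
  rcases lt_trichotomy s t with h1 | h1 | h1
  · exact absurd h ((D.hh_lt_iff hv hs ht).2 h1).ne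
  · exact h1
  · exact absurd h ((D.hh_lt_iff hv ht hs).2 h1).ne'

/-- The spheres around a vertex. -/
def sphMap (D : S.Dec) (v : ℕ × X) (t : ℝ) (q : ℝ × (Fin n → ℝ)) : X :=
  D.ψ v ((t * D.hh v q.1) • q.2)

lemma continuous_sphMap (D : S.Dec) {v : ℕ × X} (hv : S.Valid v) :
    Continuous fun p : ℝ × (ℝ × (Fin n → ℝ)) => D.sphMap v p.1 p.2 := by
  unfold sphMap hh
  refine (D.emb v hv).continuous.comp ?_
  have := continuous_clamp
  fun_prop

lemma continuous_sphMap' (D : S.Dec) {v : ℕ × X} (hv : S.Valid v) (t : ℝ) :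
    Continuous (D.sphMap v t) :=
  (D.continuous_sphMap hv).comp (by fun_prop : Continuous fun q : ℝ × (Fin n → ℝ) => (t, q))

open Classical in
/-- The spheres around a vertex. -/
def sph (D : S.Dec) (hn : 2 ≤ n) (v : ℕ × X) (t : ℝ) (z : Hyper ℝ) : Hyper X :=
  if hv : S.Valid v then
    (z ×ˢ usph hn : TopologicalSpace.NonemptyCompacts (ℝ × (Fin n → ℝ))).map (D.sphMap v t)
      (D.continuous_sphMap' hv t)
  else {v.2}

lemma mem_sph (D : S.Dec) (hn : 2 ≤ n) {v : ℕ × X} (hv : S.Valid v) {t : ℝ} {z : Hyper ℝ} {x : X} :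
    x ∈ D.sph hn v t z ↔ ∃ s ∈ z, ∃ u : Fin n → ℝ, ‖u‖ = 1 ∧ x = D.ψ v ((t * D.hh v s) • u) := by
  unfold sph
  rw [dif_pos hv, ← SetLike.mem_coe, TopologicalSpace.NonemptyCompacts.coe_map,
    TopologicalSpace.NonemptyCompacts.coe_prod]
  constructor
  · rintro ⟨⟨s, u⟩, ⟨hs, hu⟩, rfl⟩
    exact ⟨s, hs, u, mem_usph.1 hu, rfl⟩
  · rintro ⟨s, hs, u, hu, rfl⟩
    exact ⟨(s, u), ⟨hs, mem_usph.2 hu⟩, rfl⟩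

lemma exists_unit (D : S.Dec) {v : ℕ × X} (hv : S.Valid v) (z : Fin n → ℝ) :
    ∃ u : Fin n → ℝ, ‖u‖ = 1 ∧ z = ‖z‖ • u := by
  by_cases h : z = 0
  · exact ⟨D.u v, D.norm_u v hv, by simp [h]⟩
  · have h' := norm_pos_iff.2 h
    refine ⟨‖z‖⁻¹ • z, ?_, ?_⟩
    · rw [norm_smul, norm_inv, norm_norm, inv_mul_cancel₀ h'.ne']
    · rw [smul_smul, mul_inv_cancel₀ h'.ne', one_smul]

lemma mul_hh (D : S.Dec) {v : ℕ × X} (hv : S.Valid v) {t : ℝ} (h0 : 0 ≤ t) (h1 : t ≤ 1) (s : ℝ) :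
    0 ≤ t * D.hh v s ∧ t * D.hh v s ≤ 1 := by
  have a := D.hh_ge hv s
  have b := D.hh_le hv s
  have c := D.θ_pos v hv
  constructor
  · exact mul_nonneg h0 (by linarith)
  · exact mul_le_one₀ h1 (by linarith) b

lemma mem_sph' (D : S.Dec) (hn : 2 ≤ n) {v : ℕ × X} (hv : S.Valid v) {t : ℝ} (h0 : 0 ≤ t)
    (h1 : t ≤ 1) {z : Hyper ℝ} {x : X} :
    x ∈ D.sph hn v t z ↔ ∃ y : Fin n → ℝ, x = D.ψ v y ∧ ∃ s ∈ z, ‖y‖ = t * D.hh v s := by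
  rw [D.mem_sph hn hv]
  constructor
  · rintro ⟨s, hs, u, hu, rfl⟩
    refine ⟨_, rfl, s, hs, ?_⟩
    rw [norm_smul, hu, mul_one, Real.norm_of_nonneg (D.mul_hh hv h0 h1 s).1]
  · rintro ⟨y, rfl, s, hs, hy⟩
    obtain ⟨u, hu, hyu⟩ := D.exists_unit hv y
    refine ⟨s, hs, u, hu, ?_⟩
    rw [← hy, ← hyu]

/-- The decorated blob. -/
def blob (D : S.Dec) (hn : 2 ≤ n) : S.Blob (Hyper ℝ) where
  H v t z := S.star v t ⊔ D.sph hn v t z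
  cont v hv := by
    refine Continuous.sup ((S.cont v.1 v.2 hv).comp continuous_fst) ?_
    unfold sph
    simp only [dif_pos hv]
    refine Continuous.nonemptyCompacts_map'
      (f := fun q : ℝ × Hyper ℝ =>
        (q.2 ×ˢ usph hn : TopologicalSpace.NonemptyCompacts (ℝ × (Fin n → ℝ))))
      (g := fun (q : ℝ × Hyper ℝ) p => D.sphMap v q.1 p) ?_ ?_
    · exact TopologicalSpace.NonemptyCompacts.continuous_prod.comp
        (continuous_snd.prodMk continuous_const)
    · exact (D.continuous_sphMap hv).comp
        (by fun_prop : Continuous fun p : (ℝ × Hyper ℝ) × (ℝ × (Fin n → ℝ)) => (p.1.1, p.2))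
  zero v hv z := by
    have h1 : S.star v 0 = {v.2} := S.zero v.1 v.2 hv
    have h2 : D.sph hn v 0 z ≤ {v.2} := by
      intro x hx
      obtain ⟨s, hs, u, hu, rfl⟩ := (D.mem_sph hn hv).1 hx
      rw [zero_mul, zero_smul, D.center v hv]
      simp
    rw [h1]
    exact sup_eq_left.2 h2
  star_le _ _ _ _ := le_sup_left
  sub v hv t z h0 h1 := by
    rw [TopologicalSpace.NonemptyCompacts.coe_sup]
    refine union_subset ((SetLike.coe_subset_coe.2 (S.le v.1 v.2 hv t)).trans (S.sub v.1 v.2 hv)) ?_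
    intro x hx
    obtain ⟨y, rfl, s, hs, hy⟩ := (D.mem_sph' hn hv h0 h1).1 hx
    apply D.ball_sub v hv
    refine ⟨y, ?_, rfl⟩
    rw [mem_closedBall_zero_iff, hy]
    exact (D.mul_hh hv h0 h1 s).2

/-- The decorated union map. -/
def G (D : S.Dec) (hn : 2 ≤ n) (A : Hyper X) (τ : NNReal) (z : Hyper ℝ) : Hyper X :=
  S.union (D.blob hn) A τ z

lemma mem_G (D : S.Dec) (hn : 2 ≤ n) {A : Hyper X} {τ : NNReal} {z : Hyper ℝ} {x : X} :
    x ∈ D.G hn A τ z ↔ x ∈ S.skel A τ ∨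
      ∃ v, S.Near A τ v ∧ ∃ y : Fin n → ℝ, x = D.ψ v y ∧
        ∃ s ∈ z, ‖y‖ = S.act v A τ * D.hh v s := by
  unfold G
  rw [S.mem_union', S.mem_skel, ← exists_or]
  refine exists_congr fun v => ?_
  rw [← and_or_left]
  refine and_congr_right fun hv => ?_
  rw [← D.mem_sph' hn hv.1 (S.act_nonneg v A τ) (S.act_le_one v A τ)]
  change x ∈ ((S.star v (S.act v A τ) ⊔ D.sph hn v (S.act v A τ) z : Hyper X) : Set X) ↔ _
  rw [TopologicalSpace.NonemptyCompacts.coe_sup]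
  rfl

lemma skel_sub_stars {A : Hyper X} {τ : NNReal} {x : X} (hx : x ∈ S.skel A τ) :
    ∃ v, S.Near A τ v ∧ x ∈ S.star v 1 := by
  obtain ⟨v, hv, hx⟩ := S.mem_skel.1 hx
  exact ⟨v, hv, S.le v.1 v.2 hv.1 _ hx⟩

lemma mem_G_ball (D : S.Dec) (hn : 2 ≤ n) {A : Hyper X} {τ : NNReal} {z : Hyper ℝ} {v : ℕ × X}
    (hv : S.Valid v) {y : Fin n → ℝ} (hy : ‖y‖ ≤ 1)
    (hsc : ∀ w, S.Near A τ w → w.1 ≤ v.1 + 3 ∧ v.1 ≤ w.1 + 3)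
    (hst : ∀ w, S.Near A τ w → D.ψ v y ∉ S.star w 1) :
    D.ψ v y ∈ D.G hn A τ z ↔ S.Near A τ v ∧ ∃ s ∈ z, ‖y‖ = S.act v A τ * D.hh v s := by
  rw [D.mem_G hn]
  constructor
  · rintro (h | ⟨w, hw, y', hyy', s, hs, hy'⟩)
    · obtain ⟨w, hw, h⟩ := skel_sub_stars h
      exact absurd h (hst w hw)
    · have hy1 : ‖y'‖ ≤ 1 := by
        rw [hy']
        exact (D.mul_hh hw.1 (S.act_nonneg w A τ) (S.act_le_one w A τ) s).2
      have hvw : v = w := by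
        refine D.disj v w hv hw.1 (hsc w hw).2 (hsc w hw).1 ⟨D.ψ v y, ⟨y, ?_, rfl⟩, y', ?_, hyy'.symm⟩
        · rwa [mem_closedBall_zero_iff]
        · rwa [mem_closedBall_zero_iff]
      subst hvw
      have := (D.emb v hv).injective hyy'
      subst this
      exact ⟨hw, s, hs, hy'⟩
  · rintro ⟨h, s, hs, hys⟩
    exact Or.inr ⟨v, h, y, rfl, s, hs, hys⟩

lemma scale_close {A A' : Hyper X} {τ τ' : NNReal} (h : |(τ : ℝ) - τ'| < 1) {v w : ℕ × X}
    (hv : S.Core A τ v) (hw : S.Near A' τ' w) : w.1 ≤ v.1 + 3 ∧ v.1 ≤ w.1 + 3 := by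
  have h2 := abs_cs τ
  rw [← hv.2.2] at h2
  have h3 := hw.2.2
  rw [abs_le] at h2
  rw [abs_lt] at h3 h
  have e1 : (w.1 : ℝ) < v.1 + 3 := by linarith [h.1, h.2]
  have e2 : (v.1 : ℝ) < w.1 + 3 := by linarith [h.1, h.2]
  have e1' : w.1 < v.1 + 3 := by exact_mod_cast e1
  have e2' : v.1 < w.1 + 3 := by exact_mod_cast e2
  omega

lemma scale_close' {A : Hyper X} {τ : NNReal} {v w : ℕ × X}
    (hv : S.Near A τ v) (hw : S.Near A τ w) : w.1 ≤ v.1 + 2 ∧ v.1 ≤ w.1 + 2 := by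
  have h2 := hv.2.2
  have h3 := hw.2.2
  rw [abs_lt] at h3 h2
  have e1 : (w.1 : ℝ) < v.1 + 3 := by linarith [h3.1, h2.2]
  have e2 : (v.1 : ℝ) < w.1 + 3 := by linarith [h2.1, h3.2]
  have e1' : w.1 < v.1 + 3 := by exact_mod_cast e1
  have e2' : v.1 < w.1 + 3 := by exact_mod_cast e2
  omega

/-- The skeleton is not contained in any ball. -/
lemma exists_outside (D : S.Dec) {A : Hyper X} {τ : NNReal} {v : ℕ × X} (hv : S.Near A τ v) :
    ∃ x ∈ S.skel A τ, x ∉ D.ψ v '' closedBall 0 1 := by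
  obtain ⟨w, hw, -⟩ := hv.link
  obtain ⟨q, hq, hd⟩ := S.net (w.1 + 1) w.2
  have h2 := abs_cs τ
  rw [← hw.2.2] at h2
  have h3 := hv.2.2
  rw [abs_le] at h2
  rw [abs_lt] at h3
  have e1 : (w.1 : ℝ) < v.1 + 2 := by linarith [h2.1, h3.2]
  have e2 : (v.1 : ℝ) < w.1 + 2 := by linarith [h2.2, h3.1]
  have e1' : w.1 < v.1 + 2 := by exact_mod_cast e1
  have e2' : v.1 < w.1 + 2 := by exact_mod_cast e2
  have hqs : q ∈ S.star w 1 := by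
    refine S.link w.1 (w.1 + 1) w.2 q hw.1 hq (by omega) (by omega) ?_
    have := S.δ_pos w.1
    have := S.δ_pos (w.1 + 1)
    rw [dist_comm] at hd
    linarith
  have out : ∀ w' : ℕ × X, S.Valid w' → v.1 ≤ w'.1 + 3 → w'.1 ≤ v.1 + 3 → v ≠ w' →
      w'.2 ∉ D.ψ v '' closedBall 0 1 := by
    intro w' hw' h1 h2 hne hmem
    exact hne (D.disj v w' hv.1 hw' h1 h2 ⟨w'.2, hmem, 0, by simp, D.center w' hw'⟩)
  by_cases hvw : v = w
  · refine ⟨q, S.core_sub_skel hw hqs, out (w.1 + 1, q) hq ?_ ?_ ?_⟩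
    · change v.1 ≤ w.1 + 1 + 3; omega
    · change w.1 + 1 ≤ v.1 + 3; omega
    · intro h
      have := congrArg Prod.fst (hvw.symm.trans h)
      simp at this
  · exact ⟨w.2, S.near_mem_skel hw.near, out w hw.1 (by omega) (by omega) hvw⟩

lemma sphere_meets (D : S.Dec) {A : Hyper X} (hA : A ∈ CSet X) {τ : NNReal} {v : ℕ × X}
    (hv : S.Near A τ v) {r : ℝ} (h0 : 0 ≤ r) (h1 : r ≤ 1) :
    ∃ y : Fin n → ℝ, ‖y‖ = r ∧ D.ψ v y ∈ S.skel A τ := by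
  obtain ⟨x, hx, hxo⟩ := D.exists_outside hv
  by_contra hcon
  push Not at hcon
  have hemb := D.emb v hv.1
  have hr : 0 < r := by
    rcases h0.eq_or_lt with h | h
    · exfalso
      refine hcon 0 (by rw [norm_zero, h]) ?_
      rw [D.center v hv.1]
      exact S.near_mem_skel hv
    · exact h
  have hO1 : IsOpen (D.ψ v '' ball 0 r) := hemb.isOpenMap _ isOpen_ball
  have hO2 : IsOpen (D.ψ v '' closedBall 0 r)ᶜ :=
    ((isCompact_closedBall _ _).image hemb.continuous).isClosed.isOpen_compl
  obtain ⟨c, -, hc1, hc2⟩ := (S.skel_conn hA τ).isPreconnected _ _ hO1 hO2 (by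
    intro a ha
    by_cases h : a ∈ D.ψ v '' closedBall 0 r
    · left
      obtain ⟨y, hy, rfl⟩ := h
      rw [mem_closedBall_zero_iff] at hy
      refine ⟨y, ?_, rfl⟩
      rw [mem_ball_zero_iff]
      exact lt_of_le_of_ne hy fun h => hcon y h ha
    · right; exact h)
    ⟨v.2, S.near_mem_skel hv, 0, mem_ball_self hr, D.center v hv.1⟩
    ⟨x, hx, fun h => hxo (image_mono (closedBall_subset_closedBall h1) h)⟩
  exact hc2 (image_mono ball_subset_closedBall hc1)

lemma G_conn (D : S.Dec) (hn : 2 ≤ n) {A : Hyper X} (hA : A ∈ CSet X) (τ : NNReal) (z : Hyper ℝ) :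
    D.G hn A τ z ∈ CSet X := by
  have hN := S.skel_conn hA τ
  have hNG : (S.skel A τ : Set X) ⊆ D.G hn A τ z := S.skel_le_union (D.blob hn)
  obtain ⟨x₀, hx₀⟩ := (S.skel A τ).nonempty
  refine ⟨⟨x₀, hNG hx₀⟩, isPreconnected_of_forall x₀ ?_⟩
  intro x hx
  rcases (D.mem_G hn).1 hx with h | ⟨v, hv, y, rfl, s, hs, hy⟩
  · exact ⟨_, hNG, hx₀, h, hN.isPreconnected⟩
  · set r := S.act v A τ * D.hh v s with hr
    have hr' := D.mul_hh hv.1 (S.act_nonneg v A τ) (S.act_le_one v A τ) s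
    obtain ⟨y', hy', hmem⟩ := D.sphere_meets hA hv hr'.1 hr'.2
    have hsc : IsConnected (D.ψ v '' sphere 0 r) :=
      (isConnected_sphere (one_lt_rank hn) 0 hr'.1).image _ (D.emb v hv.1).continuous.continuousOn
    refine ⟨S.skel A τ ∪ D.ψ v '' sphere 0 r, union_subset hNG ?_, Or.inl hx₀,
      Or.inr ⟨y, by rwa [mem_sphere_zero_iff_norm], rfl⟩, ?_⟩
    · rintro _ ⟨w, hw, rfl⟩
      rw [mem_sphere_zero_iff_norm] at hw
      exact (D.mem_G hn).2 (Or.inr ⟨v, hv, w, rfl, s, hs, hw⟩)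
    · exact hN.isPreconnected.union _ hmem ⟨y', by rwa [mem_sphere_zero_iff_norm], rfl⟩
        hsc.isPreconnected

lemma skel_sub_Gam {A : Hyper X} {τ : NNReal} :
    (S.skel A τ : Set X) ⊆ S.Gam (⌊(τ : ℝ)⌋₊ + 3) := by
  intro x hx
  obtain ⟨v, hv, h⟩ := skel_sub_stars hx
  exact S.star_sub_Gam hv.1 hv.lt h

lemma sphere_meagre (hn : 2 ≤ n) {ψ : (Fin n → ℝ) → X} (hψ : IsOpenEmbedding ψ) (r : ℝ) :
    IsMeagre (ψ '' sphere 0 r) := by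
  have hnt : Nontrivial (Fin n → ℝ) := by
    have : Nonempty (Fin n) := ⟨⟨0, by omega⟩⟩
    infer_instance
  apply IsNowhereDense.isMeagre
  rw [((isCompact_sphere _ _).image hψ.continuous).isClosed.isNowhereDense_iff]
  have h1 : ψ ⁻¹' interior (ψ '' sphere 0 r) ⊆ interior (sphere 0 r) := by
    apply interior_maximal _ (isOpen_interior.preimage hψ.continuous)
    intro y hy
    obtain ⟨y', hy', h⟩ := interior_subset hy
    rwa [← hψ.injective h]
  rw [interior_sphere'] at h1
  rw [eq_empty_iff_forall_notMem]
  intro x hx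
  obtain ⟨y, hy, rfl⟩ := interior_subset hx
  exact h1 hx

lemma G_interior [CompactSpace X] (D : S.Dec) (hn : 2 ≤ n) (A : Hyper X) (τ : NNReal)
    {z : Hyper ℝ} (hz : (z : Set ℝ).Countable) : interior (D.G hn A τ z : Set X) = ∅ := by
  have hsub : (D.G hn A τ z : Set X) ⊆ S.Gam (⌊(τ : ℝ)⌋₊ + 3) ∪
      ⋃ v ∈ (S.nearF A τ : Set (ℕ × X)), ⋃ s ∈ (z : Set ℝ),
        D.ψ v '' sphere 0 (S.act v A τ * D.hh v s) := by
    intro x hx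
    rcases (D.mem_G hn).1 hx with h | ⟨v, hv, y, rfl, s, hs, hy⟩
    · exact Or.inl (skel_sub_Gam h)
    · right
      refine mem_iUnion₂.2 ⟨v, S.mem_nearF.2 hv, mem_iUnion₂.2 ⟨s, hs, y, ?_, rfl⟩⟩
      rwa [mem_sphere_zero_iff_norm]
  apply IsMeagre.interior_eq
  refine IsMeagre.mono hsub ((S.Gam_meagre _).union ?_)
  refine isMeagre_biUnion (S.nearF A τ).finite_toSet.countable fun v hv => ?_
  exact isMeagre_biUnion hz fun s _ => sphere_meagre hn (D.emb v (S.mem_nearF.1 hv).1) _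

lemma G_mem_CB [CompactSpace X] [Nonempty X] (D : S.Dec) (hn : 2 ≤ n) {A : Hyper X}
    (hA : A ∈ CSet X) (τ : NNReal) {z : Hyper ℝ} (hz : (z : Set ℝ).Countable) :
    D.G hn A τ z ∈ CBSet X := by
  have hi := D.G_interior hn A τ hz
  have hc := D.G_conn hn hA τ z
  refine ⟨hc, ?_, ?_⟩
  · intro h
    rw [h, interior_univ] at hi
    exact (univ_nonempty (α := X)).ne_empty hi
  · rw [(D.G hn A τ z).isCompact.isClosed.frontier_eq, hi, diff_empty]
    exact hc

/-- The off-skeleton radius lemma. -/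
lemma exists_off [CompactSpace X] (D : S.Dec) {A : Hyper X} {τ : NNReal} {v : ℕ × X}
    (hv : S.Near A τ v) {r r' : ℝ} (h0 : 0 ≤ r) (h1 : r < r') :
    ∃ y : Fin n → ℝ, r < ‖y‖ ∧ ‖y‖ < r' ∧ ∀ w, S.Near A τ w → D.ψ v y ∉ S.star w 1 := by
  have hopen : IsOpen {y : Fin n → ℝ | r < ‖y‖ ∧ ‖y‖ < r'} :=
    (isOpen_lt continuous_const continuous_norm).inter (isOpen_lt continuous_norm continuous_const)
  by_contra hcon
  push Not at hcon
  have h2 : D.ψ v '' {y : Fin n → ℝ | r < ‖y‖ ∧ ‖y‖ < r'} ⊆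
      interior (S.Gam (⌊(τ : ℝ)⌋₊ + 3)) := by
    apply interior_maximal _ ((D.emb v hv.1).isOpenMap _ hopen)
    rintro _ ⟨y, hy, rfl⟩
    obtain ⟨w, hw, h⟩ := hcon y hy.1 hy.2
    exact S.star_sub_Gam hw.1 hw.lt h
  rw [IsMeagre.interior_eq (S.Gam_meagre _)] at h2
  refine h2 ⟨((r + r') / 2) • D.u v, ?_, rfl⟩
  have : ‖((r + r') / 2) • D.u v‖ = (r + r') / 2 := by
    rw [norm_smul, D.norm_u v hv.1, mul_one, Real.norm_of_nonneg (by linarith)]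
  constructor
  · rw [this]; linarith
  · rw [this]; linarith

lemma G_notMem_CB [CompactSpace X] (D : S.Dec) (hn : 2 ≤ n) (A : Hyper X)
    (τ : NNReal) {z : Hyper ℝ} (hz : (z : Set ℝ) ⊆ Icc 0 1) {a b c d : ℝ} (ha : 0 < a)
    (hab : a < b) (hbc : b < c) (hcd : c < d) (hd : d ≤ 1) (hsub : Icc b c ⊆ (z : Set ℝ))
    (hg1 : Disjoint (z : Set ℝ) (Ioo a b)) (hg2 : Disjoint (z : Set ℝ) (Ioo c d)) :
    D.G hn A τ z ∉ CBSet X := by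
  obtain ⟨a₀, ha₀⟩ := A.nonempty
  obtain ⟨v, hvc, -⟩ := S.exists_core τ ha₀
  have hv := hvc.near
  have hact := S.act_eq_one hvc
  have hemb := D.emb v hv.1
  have hθ := D.θ_pos v hv.1
  have ia : a ∈ Icc (0 : ℝ) 1 := ⟨by linarith, by linarith⟩
  have ib : b ∈ Icc (0 : ℝ) 1 := ⟨by linarith, by linarith⟩
  have ic : c ∈ Icc (0 : ℝ) 1 := ⟨by linarith, by linarith⟩
  have id : d ∈ Icc (0 : ℝ) 1 := ⟨by linarith, by linarith⟩
  have hmono : ∀ {s t : ℝ}, s ∈ Icc (0 : ℝ) 1 → t ∈ Icc (0 : ℝ) 1 →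
    (D.hh v s < D.hh v t ↔ s < t) := fun hs ht => D.hh_lt_iff hv.1 hs ht
  have lab := (hmono ia ib).2 hab
  have lbc := (hmono ib ic).2 hbc
  have lcd := (hmono ic id).2 hcd
  have pa := D.hh_ge hv.1 a
  have pd := D.hh_le hv.1 d
  have hread : ∀ y : Fin n → ℝ, ‖y‖ ≤ 1 → (∀ w, S.Near A τ w → D.ψ v y ∉ S.star w 1) →
      D.ψ v y ∈ D.G hn A τ z → ∃ s ∈ (z : Set ℝ), ‖y‖ = D.hh v s := by
    intro y hy hst hmem
    obtain ⟨-, s, hs, h⟩ := (D.mem_G_ball hn hv.1 hy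
      (fun w hw => scale_close (by simp) hvc hw) hst).1 hmem
    exact ⟨s, hs, by rw [h, hact, one_mul]⟩
  have hout : ∀ s t : ℝ, s ∈ Icc (0 : ℝ) 1 → t ∈ Icc (0 : ℝ) 1 → s < t →
      Disjoint (z : Set ℝ) (Ioo s t) →
      ∃ y : Fin n → ℝ, D.hh v s < ‖y‖ ∧ ‖y‖ < D.hh v t ∧ D.ψ v y ∉ D.G hn A τ z := by
    intro s t hs ht hst hdis
    have := D.hh_ge hv.1 s
    have h1 := D.hh_le hv.1 t
    obtain ⟨y, hy1, hy2, hy3⟩ := D.exists_off hv (by linarith) ((hmono hs ht).2 hst)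
    refine ⟨y, hy1, hy2, fun hmem => ?_⟩
    obtain ⟨s', hs', h'⟩ := hread y (by linarith) hy3 hmem
    rw [h'] at hy1 hy2
    exact Set.disjoint_left.1 hdis hs' ⟨(hmono hs (hz hs')).1 hy1, (hmono (hz hs') ht).1 hy2⟩
  have hin : ∀ y : Fin n → ℝ, D.hh v b ≤ ‖y‖ → ‖y‖ ≤ D.hh v c → D.ψ v y ∈ D.G hn A τ z := by
    intro y h1 h2
    have hθ1 := D.θ_lt v hv.1
    have hcont : ContinuousOn (D.hh v) (Icc b c) := by
      unfold hh
      have := continuous_clamp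
      fun_prop
    obtain ⟨s, hs, hsy⟩ := intermediate_value_Icc hbc.le hcont ⟨h1, h2⟩
    exact (D.mem_G hn).2 (Or.inr ⟨v, hv, y, rfl, s, hsub hs, by rw [hact, one_mul, hsy]⟩)
  obtain ⟨y1, hy1a, hy1b, hy1⟩ := hout a b ia ib hab hg1
  obtain ⟨y2, hy2a, hy2b, hy2⟩ := hout c d ic id hcd hg2
  set r := (D.hh v b + D.hh v c) / 2 with hr
  have hO1 : IsOpen (D.ψ v '' ball 0 r) := hemb.isOpenMap _ isOpen_ball
  have hO2 : IsOpen (D.ψ v '' closedBall 0 r)ᶜ :=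
    ((isCompact_closedBall _ _).image hemb.continuous).isClosed.isOpen_compl
  have hann : D.ψ v '' {y | D.hh v b < ‖y‖ ∧ ‖y‖ < D.hh v c} ⊆ interior (D.G hn A τ z : Set X) := by
    apply interior_maximal
    · rintro _ ⟨y, hy, rfl⟩
      exact hin y hy.1.le hy.2.le
    · exact hemb.isOpenMap _ ((isOpen_lt continuous_const continuous_norm).inter
        (isOpen_lt continuous_norm continuous_const))
  rintro ⟨-, -, hF⟩
  have hnorm : ∀ t : ℝ, 0 ≤ t → ‖t • D.u v‖ = t := fun t ht => by
    rw [norm_smul, D.norm_u v hv.1, mul_one, Real.norm_of_nonneg ht]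
  obtain ⟨x, -, hx1, hx2⟩ := hF.isPreconnected _ _ hO1 hO2 (by
    intro x hx
    by_cases h : x ∈ D.ψ v '' closedBall 0 r
    · left
      obtain ⟨y, hy, rfl⟩ := h
      rw [mem_closedBall_zero_iff] at hy
      refine ⟨y, ?_, rfl⟩
      rw [mem_ball_zero_iff]
      refine lt_of_le_of_ne hy fun h => hx.2 (hann ⟨y, ⟨?_, ?_⟩, rfl⟩)
      · rw [h]; linarith
      · rw [h]; linarith
    · right; exact h)
    (by
      have hpc : IsPreconnected (D.ψ v '' ball 0 r) :=
        (convex_ball (0 : Fin n → ℝ) r).isPreconnected.image _ hemb.continuous.continuousOn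
      obtain ⟨x, hx, hxF⟩ := frontier_meets hpc (s := (D.G hn A τ z : Set X))
        ⟨D.ψ v (D.hh v b • D.u v), ⟨_, by rw [mem_ball_zero_iff, hnorm _ (by linarith)]; linarith, rfl⟩,
          hin _ (by rw [hnorm _ (by linarith)]) (by rw [hnorm _ (by linarith)]; linarith)⟩
        ⟨D.ψ v y1, ⟨y1, by rw [mem_ball_zero_iff]; linarith, rfl⟩, hy1⟩
      exact ⟨x, hxF, hx⟩)
    (by
      have hy2p : 0 < ‖y2‖ := by linarith
      have hpc : IsPreconnected ((fun t : ℝ => D.ψ v (t • y2)) '' Icc (D.hh v c / ‖y2‖) 1) :=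
        isPreconnected_Icc.image _ (hemb.continuous.comp (by fun_prop)).continuousOn
      have hle : D.hh v c / ‖y2‖ ≤ 1 := by rw [div_le_one hy2p]; exact hy2a.le
      have hq : 0 ≤ D.hh v c / ‖y2‖ := div_nonneg (by linarith) hy2p.le
      have hnq : ‖(D.hh v c / ‖y2‖) • y2‖ = D.hh v c := by
        rw [norm_smul, Real.norm_of_nonneg hq, div_mul_cancel₀ _ hy2p.ne']
      obtain ⟨x, ⟨t, ht, rfl⟩, hxF⟩ := frontier_meets hpc (s := (D.G hn A τ z : Set X))
        ⟨_, ⟨D.hh v c / ‖y2‖, ⟨le_rfl, hle⟩, rfl⟩, hin _ (by rw [hnq]; exact lbc.le) hnq.le⟩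
        ⟨_, ⟨1, ⟨hle, le_rfl⟩, rfl⟩, by
          change D.ψ v ((1 : ℝ) • y2) ∉ D.G hn A τ z
          rw [one_smul]; exact hy2⟩
      refine ⟨_, hxF, ?_⟩
      rintro ⟨y, hy, hyt⟩
      rw [hemb.injective hyt, mem_closedBall_zero_iff, norm_smul,
        Real.norm_of_nonneg (hq.trans ht.1)] at hy
      have := (div_le_iff₀ hy2p).1 ht.1
      linarith)
  exact hx2 (image_mono ball_subset_closedBall hx1)

end Dec

end Sys

end CBU


namespace CBU

/-! ### Assembly -/

variable {X : Type*} [MetricSpace X] {n : ℕ} {E : Finset X}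

lemma exists_rho {Q : Type*} [MetricSpace Q] {Z : Set Q} (hZ : IsClosed Z) {ε : ℝ} (hε : 0 < ε) :
    ∃ ρ : Q → ℝ, (∀ a b, |ρ a - ρ b| ≤ dist a b) ∧ (∀ a, 0 ≤ ρ a) ∧ (∀ a, ρ a ≤ ε) ∧
      ∀ a, ρ a = 0 ↔ a ∈ Z := by
  rcases Z.eq_empty_or_nonempty with rfl | hne
  · exact ⟨fun _ => ε, by simp, fun _ => hε.le, fun _ => le_rfl, by simp [hε.ne']⟩
  · refine ⟨fun a => min ε (infDist a Z), fun a b => ?_, fun a => le_min hε.le infDist_nonneg,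
      fun a => min_le_left _ _, fun a => ?_⟩
    · have h1 : infDist a Z ≤ infDist b Z + dist a b := infDist_le_infDist_add_dist
      have h2 : infDist b Z ≤ infDist a Z + dist b a := infDist_le_infDist_add_dist
      rw [dist_comm b a] at h2
      refine (abs_min_sub_min_le_max _ _ _ _).trans ?_
      simp only [sub_self, abs_zero]
      exact max_le dist_nonneg (abs_le.2 ⟨by linarith, by linarith⟩)
    · rw [hZ.mem_iff_infDist_zero hne]
      constructor
      · intro h
        rcases min_choice ε (infDist a Z) with h' | h'
        · exact absurd (h'.symm.trans h) hε.ne'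
        · exact h'.symm.trans h
      · intro h; simp [h, hε.le]

lemma Sys.continuous_skel (S : Sys X n E) {Y : Type*} [TopologicalSpace Y] {φ : Y → Hyper X}
    (hφ : Continuous φ) (τ : NNReal) : Continuous fun a => S.skel (φ a) τ := by
  have h2 : Continuous fun a : Y => ((φ a, τ), ()) :=
    (hφ.prodMk continuous_const).prodMk continuous_const
  have h3 := S.continuous_union S.starBlob
  have h4 := h3.comp h2
  have h5 : (fun a => S.skel (φ a) τ) = (fun q : (Hyper X × NNReal) × Unit => S.union S.starBlob q.1.1 q.1.2 q.2) ∘ (fun a : Y => ((φ a, τ), ())) := by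
    funext a
    rfl
  rw [h5]
  exact h4

namespace Sys.Dec

variable {S : Sys X n E}

lemma G_seg [CompactSpace X] (D : S.Dec) (hn : 2 ≤ n) {A A' : Hyper X} {τ τ' : NNReal} {z : Hyper ℝ}
    (h : |(τ : ℝ) - τ'| < 1) {v : ℕ × X} (hv : S.Core A τ v) {t : ℝ} (ht : D.θ v ≤ t)
    (ht1 : t ≤ 1) :
    D.ψ v (t • D.u v) ∈ D.G hn A' τ' z ↔ S.Near A' τ' v ∧ ∃ s ∈ z, t = S.act v A' τ' * D.hh v s := by
  have ht0 : 0 < t := (D.θ_pos v hv.1).trans_le ht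
  have hnorm : ‖t • D.u v‖ = t := by
    rw [norm_smul, D.norm_u v hv.1, mul_one, Real.norm_of_nonneg ht0.le]
  have key := D.mem_G_ball hn (A := A') (τ := τ') (z := z) (v := v) (y := t • D.u v) hv.1
    (by rw [hnorm]; exact ht1) (fun w hw => scale_close h hv hw)
    (fun w hw => D.seg v w hv.1 hw.1 (scale_close h hv hw).1 t ht ht1)
  rw [key, hnorm]

lemma G_inj [CompactSpace X] (D : S.Dec) (hn : 2 ≤ n) {A A' : Hyper X} {τ τ' : NNReal}
    {z z' : Hyper ℝ} (h : |(τ : ℝ) - τ'| < 1) (hz : (z : Set ℝ) ⊆ Icc 0 1)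
    (hz' : (z' : Set ℝ) ⊆ Icc 0 1) (h1 : (1 : ℝ) ∈ z)
    (heq : D.G hn A τ z = D.G hn A' τ' z') : z = z' := by
  obtain ⟨a, ha⟩ := A.nonempty
  obtain ⟨v, hv, -⟩ := S.exists_core τ ha
  have h0 : |(τ : ℝ) - τ| < 1 := by simp
  have e1 : ∀ t, D.θ v ≤ t → t ≤ 1 → (D.ψ v (t • D.u v) ∈ D.G hn A τ z ↔ ∃ s ∈ z, t = D.hh v s) := by
    intro t ht ht1
    rw [D.G_seg hn h0 hv ht ht1, S.act_eq_one hv]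
    simp [hv.near]
  have e2 : ∀ t, D.θ v ≤ t → t ≤ 1 → (D.ψ v (t • D.u v) ∈ D.G hn A τ z ↔
      S.Near A' τ' v ∧ ∃ s ∈ z', t = S.act v A' τ' * D.hh v s) := by
    intro t ht ht1
    rw [heq, D.G_seg hn h hv ht ht1]
  have hθ := D.θ_lt v hv.1
  obtain ⟨hnear, s, hs, hs1⟩ := (e2 1 hθ.le le_rfl).1 ((e1 1 hθ.le le_rfl).2 ⟨1, h1, (D.hh_one v).symm⟩)
  have hact : S.act v A' τ' = 1 := by
    have a1 := S.act_le_one v A' τ'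
    have a0 := S.act_nonneg v A' τ'
    have b1 := D.hh_le hv.1 s
    nlinarith
  rw [hact] at e2
  simp only [one_mul, hnear, true_and] at e2
  have e3 : ∀ s ∈ Icc (0:ℝ) 1, ∀ y : Hyper ℝ, (y : Set ℝ) ⊆ Icc 0 1 →
      ((∃ s' ∈ y, D.hh v s = D.hh v s') ↔ s ∈ y) := by
    intro s hs y hy
    constructor
    · rintro ⟨s', hs', he⟩
      rw [D.hh_inj hv.1 hs (hy hs') he]; exact hs'
    · intro h; exact ⟨s, h, rfl⟩
  ext s
  constructor
  · intro hs
    have hm := hz hs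
    have := (e2 _ (D.hh_ge hv.1 s) (D.hh_le hv.1 s)).1
      ((e1 _ (D.hh_ge hv.1 s) (D.hh_le hv.1 s)).2 ⟨s, hs, rfl⟩)
    exact (e3 s hm z' hz').1 this
  · intro hs
    have hm := hz' hs
    have := (e1 _ (D.hh_ge hv.1 s) (D.hh_le hv.1 s)).1
      ((e2 _ (D.hh_ge hv.1 s) (D.hh_le hv.1 s)).2 ⟨s, hs, rfl⟩)
    exact (e3 s hm z hz).1 this

lemma zset_of_marks [CompactSpace X] [LocallyConnectedSpace X] (hn : 2 ≤ n) (hE : PiEuclidean X n)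
    (D : S.Dec) {R Z : Set ↥(CSet X)} (hR : IsClosed R) (hZ : IsZSet Z) (ρ : ↥(CSet X) → ℝ)
    (hρ : ∀ a b, |ρ a - ρ b| ≤ dist a b) (hρ0 : ∀ a, 0 ≤ ρ a) (hρZ : ∀ a, ρ a = 0 ↔ a ∈ Z)
    (H : ∀ κ : ℝ, 0 < κ → ∃ M0 : ℕ, ∀ a ∈ R, κ ≤ ρ a →
      ∃ v, S.Valid v ∧ v.1 < M0 ∧ D.ψ v (D.u v) ∈ (a : Hyper X)) : IsZSet R := by
  classical
  refine ⟨hR, fun ε hε => ?_⟩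
  obtain ⟨φ, hφc, hφd, hφZ⟩ := hZ.2 (ε / 2) (by positivity)
  have : CompactSpace ↥(CSet X) := isCompact_iff_compactSpace.1 isClosed_CSet.isCompact
  have hρc : Continuous ρ := by
    have : LipschitzWith 1 ρ := LipschitzWith.of_dist_le_mul (by simpa [Real.dist_eq] using hρ)
    exact this.continuous
  obtain ⟨κ, hκ, hκφ⟩ : ∃ κ : ℝ, 0 < κ ∧ ∀ a, κ ≤ ρ (φ a) := by
    rcases isEmpty_or_nonempty ↥(CSet X) with he | hne
    · exact ⟨1, one_pos, fun a => he.elim a⟩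
    · obtain ⟨a, -, ha⟩ := isCompact_univ.exists_isMinOn (univ_nonempty (α := ↥(CSet X)))
        (hρc.comp hφc).continuousOn
      refine ⟨ρ (φ a), lt_of_le_of_ne (hρ0 _) fun h => hφZ a ((hρZ _).1 h.symm), fun b => ?_⟩
      exact ha (mem_univ b)
  obtain ⟨M0, hM0⟩ := H (κ / 2) (by positivity)
  obtain ⟨S'⟩ := exists_sys hn hE ((S.verts M0).image fun v => D.ψ v (D.u v)) (by
    intro s hs
    obtain ⟨v, hv, rfl⟩ := Finset.mem_image.1 hs
    exact isEuc_of_chart (D.emb v (S.mem_verts.1 hv).1) _)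
  obtain ⟨m, hm⟩ : ∃ m : ℕ, (2 : ℝ)⁻¹ ^ m < min (ε / 2) (κ / 2) :=
    exists_pow_lt_of_lt_one (by positivity) (by norm_num)
  have hd : ∀ A : Hyper X, dist (S'.skel A m) A < min (ε / 2) (κ / 2) := by
    intro A
    refine (S'.dist_union_le S'.starBlob A m ()).trans_lt ?_
    have e : (2 : ℝ) ^ (-((m : NNReal) : ℝ)) = (2 : ℝ)⁻¹ ^ m := by
      rw [Real.rpow_neg (by norm_num)]; simp
    rw [e]
    have : (0 : ℝ) < (2 : ℝ)⁻¹ ^ m := by positivity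
    linarith
  refine ⟨fun a => ⟨S'.skel (φ a) m, S'.skel_conn (φ a).2 m⟩, ?_, ?_, ?_⟩
  · refine Continuous.subtype_mk ?_ _
    exact S'.continuous_skel (continuous_subtype_val.comp hφc) _
  · intro a
    have h1 := hd (φ a)
    have h2 := hφd a
    have h3 := lt_min_iff.1 h1
    rw [Subtype.dist_eq] at h2 ⊢
    have := dist_triangle (S'.skel (φ a) m) (φ a) (a : Hyper X)
    simp only at this ⊢
    linarith [h3.1]
  · intro a ha
    have h1 := hd (φ a)
    have h3 := lt_min_iff.1 h1
    have h4 := hρ ⟨S'.skel (φ a) m, S'.skel_conn (φ a).2 m⟩ (φ a)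
    rw [Subtype.dist_eq] at h4
    simp only at h4
    rw [abs_le] at h4
    obtain ⟨v, hv, hvM, hmem⟩ := hM0 _ ha (by linarith [hκφ a, h3.2, h4.1])
    obtain ⟨w, hw, hw'⟩ := skel_sub_stars hmem
    exact S'.avoid w.1 w.2 hw.1 _ (Finset.mem_image.2 ⟨v, S.mem_verts.2 ⟨hv, hvM⟩, rfl⟩) hw'

end Sys.Dec

lemma two_rpow_neg_log {r : ℝ} (h0 : 0 < r) (h1 : r ≤ 1) :
    (2 : ℝ) ^ (-((Real.toNNReal (-Real.logb 2 r) : NNReal) : ℝ)) = r := by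
  have : Real.logb 2 r ≤ 0 := Real.logb_nonpos (by norm_num) h0.le h1
  rw [Real.coe_toNNReal _ (by linarith), neg_neg, Real.rpow_logb (by norm_num) (by norm_num) h0]

theorem main_universal (X : Type*) [MetricSpace X] [CompactSpace X]
    [Nonempty X] [LocallyConnectedSpace X] (n : ℕ) (hn : 2 ≤ n) (hE : PiEuclidean X n) :
    StronglyUniversal {M : Set Iinf | IsFsigma M}
      {A : ↥(CSet X) | (A : Hyper X) ∉ CBSet X} := by
  classical
  rintro M ⟨F, hF, rfl⟩ K hK f hf hfZ ε₀ hε₀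
  obtain ⟨S⟩ := exists_sys hn hE ∅ (by simp)
  obtain ⟨D⟩ := S.exists_dec hn
  obtain ⟨c, hc, hcinj, hcI, hc1, hcount, hcode⟩ := exists_code F hF
  set ε := min ε₀ 1 with hεdef
  have hε : 0 < ε := lt_min hε₀ one_pos
  have hε1 : ε ≤ 1 := min_le_right _ _
  have hεε : ε ≤ ε₀ := min_le_left _ _
  obtain ⟨ρ, hρ, hρ0, hρε, hρZ⟩ := exists_rho hfZ.1 hε
  have hρc : Continuous ρ := by
    have : LipschitzWith 1 ρ := LipschitzWith.of_dist_le_mul (by simpa [Real.dist_eq] using hρ)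
    exact this.continuous
  have hρK : ∀ x, ρ (f x) = 0 ↔ x ∈ K := by
    intro x
    rw [hρZ, hf.injective.mem_set_image]
  have hρpos : ∀ x, x ∉ K → 0 < ρ (f x) := fun x hx =>
    lt_of_le_of_ne (hρ0 _) fun h => hx ((hρK x).1 h.symm)
  set τ : Iinf → NNReal := fun x => Real.toNNReal (-Real.logb 2 (ρ (f x))) with hτ
  have hτρ : ∀ x, x ∉ K → (2 : ℝ) ^ (-((τ x : NNReal) : ℝ)) = ρ (f x) := fun x hx =>
    two_rpow_neg_log (hρpos x hx) ((hρε _).trans hε1)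
  set G : Iinf → ↥(CSet X) := fun x => ⟨D.G hn (f x) (τ x) (c x), D.G_conn hn (f x).2 _ _⟩ with hG
  set g : Iinf → ↥(CSet X) := fun x => if x ∈ K then f x else G x with hg
  have gK : ∀ x ∈ K, g x = f x := fun x hx => if_pos hx
  have gG : ∀ x, x ∉ K → g x = G x := fun x hx => if_neg hx
  have hd : ∀ x, dist (g x) (f x) ≤ ρ (f x) / 16 := by
    intro x
    by_cases hx : x ∈ K
    · rw [gK x hx, dist_self]; have := hρ0 (f x); positivity
    · rw [gG x hx, Subtype.dist_eq, ← hτρ x hx]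
      exact S.dist_union_le (D.blob hn) _ _ _
  have hrat : ∀ x, |ρ (g x) - ρ (f x)| ≤ ρ (f x) / 16 := fun x => (hρ _ _).trans (hd x)
  have hgc : Continuous g := by
    rw [continuous_iff_continuousAt]
    intro x
    by_cases hx : x ∈ K
    · have h1 : Filter.Tendsto (fun y => dist (g y) (f y)) (𝓝 x) (𝓝 0) := by
        refine squeeze_zero (fun _ => dist_nonneg) hd ?_
        have : Filter.Tendsto (fun y => ρ (f y) / 16) (𝓝 x) (𝓝 (ρ (f x) / 16)) :=
          ((hρc.comp hf.continuous).div_const 16).tendsto x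
        rwa [(hρK x).2 hx, zero_div] at this
      have h2 : Filter.Tendsto f (𝓝 x) (𝓝 (f x)) := hf.continuous.tendsto x
      have h3 : Filter.Tendsto g (𝓝 x) (𝓝 (f x)) :=
        (tendsto_iff_of_dist h1).2 h2
      unfold ContinuousAt
      rw [gK x hx]; exact h3
    · have hev : ∀ᶠ y in 𝓝 x, g y = G y := by
        filter_upwards [hK.isClosed.isOpen_compl.mem_nhds hx] with y hy using gG y hy
      refine ContinuousAt.congr ?_ (hev.mono fun y hy => hy.symm)
      rw [IsInducing.subtypeVal.continuousAt_iff]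
      have hτc : ContinuousAt τ x := by
        refine continuous_real_toNNReal.continuousAt.comp ?_
        refine ContinuousAt.neg ?_
        unfold Real.logb
        exact ((hρc.comp hf.continuous).continuousAt.log (hρpos x hx).ne').div_const _
      have h2 : ContinuousAt (fun y => (((f y : Hyper X), τ y), c y)) x :=
        ((continuous_subtype_val.comp hf.continuous).continuousAt.prodMk hτc).prodMk hc.continuousAt
      exact ((S.continuous_union (D.blob hn)).continuousAt (x := (((f x : Hyper X), τ x), c x))).comp
        (f := fun y => (((f y : Hyper X), τ y), c y)) h2
  have hgK : ∀ x, x ∉ K → ρ (g x) ≠ 0 := by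
    intro x hx h
    have h1 := hrat x
    have h2 := hρpos x hx
    rw [h, abs_le] at h1
    linarith [h1.1]
  have hgi : Function.Injective g := by
    intro x x' hxx
    by_cases hx : x ∈ K <;> by_cases hx' : x' ∈ K
    · rw [gK x hx, gK x' hx'] at hxx; exact hf.injective hxx
    · exact absurd (by rw [← hxx, gK x hx]; exact (hρK x).2 hx) (hgK x' hx')
    · exact absurd (by rw [hxx, gK x' hx']; exact (hρK x').2 hx') (hgK x hx)
    · have h1 := abs_le.1 (hrat x)
      have h2 := abs_le.1 (hrat x')
      rw [← hxx] at h2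
      have p1 := hρpos x hx
      have p2 := hρpos x' hx'
      have q1 := hτρ x hx
      have q2 := hτρ x' hx'
      have hlt : ∀ a b : ℝ, (2:ℝ) ^ (-a) < 2 * (2:ℝ) ^ (-b) → b - a < 1 := by
        intro a b hab
        have : (2:ℝ) * (2:ℝ) ^ (-b) = (2:ℝ) ^ (1 - b) := by
          rw [sub_eq_add_neg, Real.rpow_add (by norm_num), Real.rpow_one]
        rw [this, Real.rpow_lt_rpow_left_iff (by norm_num)] at hab
        linarith
      have hτ1 : |(τ x : ℝ) - τ x'| < 1 := by
        rw [abs_lt]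
        constructor
        · have := hlt (τ x) (τ x') (by rw [q1, q2]; linarith)
          linarith
        · exact hlt (τ x') (τ x) (by rw [q1, q2]; linarith)
      rw [gG x hx, gG x' hx'] at hxx
      exact hcinj (D.G_inj hn hτ1 (hcI x) (hcI x') (hc1 x) (congrArg Subtype.val hxx))
  have hcl := hgc.isClosedEmbedding hgi
  refine ⟨g, hcl.isEmbedding, ?_, ?_, gK, ?_⟩
  · refine D.zset_of_marks hn hE hcl.isClosed_range hfZ ρ hρ hρ0 hρZ ?_
    intro κ hκ
    obtain ⟨m, hm⟩ : ∃ m : ℕ, (2 : ℝ)⁻¹ ^ m < κ / 2 :=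
      exists_pow_lt_of_lt_one (by positivity) (by norm_num)
    refine ⟨m + 2, ?_⟩
    rintro _ ⟨x, rfl⟩ hκx
    have hx : x ∉ K := by
      intro hx
      rw [gK x hx, (hρK x).2 hx] at hκx
      linarith
    obtain ⟨a, ha⟩ := (f x : Hyper X).nonempty
    obtain ⟨v, hv, -⟩ := S.exists_core (τ x) ha
    have h1 := abs_le.1 (hrat x)
    have q1 := hτρ x hx
    have hτm : (τ x : ℝ) < m := by
      have h3 : (2 : ℝ)⁻¹ ^ m = (2 : ℝ) ^ (-(m : ℝ)) := by
        rw [Real.rpow_neg (by norm_num)]; simp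
      have : (2 : ℝ) ^ (-(m : ℝ)) < (2 : ℝ) ^ (-((τ x : NNReal) : ℝ)) := by
        rw [q1, ← h3]
        have := hρpos x hx
        linarith [h1.2]
      rw [Real.rpow_lt_rpow_left_iff (by norm_num)] at this
      linarith
    refine ⟨v, hv.1, ?_, ?_⟩
    · have := abs_le.1 (Sys.abs_cs (τ x))
      rw [← hv.2.2] at this
      have : (v.1 : ℝ) < ((m + 2 : ℕ) : ℝ) := by push_cast; linarith [this.1]
      exact_mod_cast this
    · rw [gG x hx]
      have := (D.G_seg hn (A' := f x) (τ' := τ x) (z := c x) (by simp) hv (t := 1)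
        (D.θ_lt v hv.1).le le_rfl).2 ⟨hv.near, 1, hc1 x, by rw [S.act_eq_one hv, D.hh_one, one_mul]⟩
      rwa [one_smul] at this
  · intro x
    have h1 := hd x
    have h2 := hρε (f x)
    linarith
  · ext x
    simp only [mem_sdiff, mem_preimage]
    refine and_congr_left fun hx => ?_
    rw [gG x hx]
    constructor
    · intro h
      by_contra hcon
      exact h (D.G_mem_CB hn (f x).2 (τ x) (hcount x hcon))
    · intro h
      obtain ⟨a, b, c', d, ha, hab, hbc, hcd, hd1, hsub, hg1, hg2⟩ := hcode x h
      exact D.G_notMem_CB hn (f x) (τ x) (hcI x) ha hab hbc hcd hd1 hsub hg1 hg2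

end CBU

/-- If `X` is a nondegenerate unicoherent Peano continuum which is
π-`n`-Euclidean, `2 ≤ n < ∞`, then `C(X) \ CB(X)` is strongly `F_σ`-universal in the
Hilbert cube `C(X)`. -/
theorem compl_CBSet_strongly_Fsigma_universal (X : Type*) [MetricSpace X] [CompactSpace X]
    [ConnectedSpace X] [Nontrivial X] [LocallyConnectedSpace X]
    (huc : Unicoherent X) (n : ℕ) (hn : 2 ≤ n) (hE : PiEuclidean X n) :
    StronglyUniversal {M : Set Iinf | IsFsigma M}
      {A : ↥(CSet X) | (A : Hyper X) ∉ CBSet X} := by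
  exact CBU.main_universal X n hn hE
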